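/- arXiv:1604.00338 — 2 statements merged into one kernel-verified Lean document; each statement's English description precedes it below -/
import Mathlib

section
/- Let I, J ⊆ {1,…,n} be not weakly separated, and let m ≥ max(|I|,|J|). Let K be a field of characteristic zero and q ∈ K a nonzero element transcendental over ℚ. Then there exist an associative unital K-algebra A and an m×n q-matrix x with entries in A such that for every integer c, the flag quantum minors satisfy [I]·[J] ≠ q^c [J]·[I]. -/
/-- Number of inversions of a permutation of `Fin k`. -/
def permInversions {k : ℕ} (σ : Equiv.Perm (Fin k)) : ℕ :=
  (Finset.univ.filter (fun p : Fin k × Fin k => p.1 < p.2 ∧ σ p.2 < σ p.1)).card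

/-- The quantum minor `[I|J]_q` of a matrix `x` (indexed by `ℕ`, rows/columns `1,…`),
with row set `I` and column set `J` (both listed in increasing order). -/
noncomputable def qMinor {K : Type} [Field K] {A : Type} [Ring A] [Algebra K A]
    (q : K) (x : ℕ → ℕ → A) (I J : Finset ℕ) : A :=
  if h : I.card = J.card then
    ∑ σ : Equiv.Perm (Fin I.card),
      ((-q) ^ permInversions σ) •
        (List.ofFn (fun d : Fin I.card =>
          x (I.orderEmbOfFin rfl d) (J.orderEmbOfFin h.symm (σ d)))).prod
  else 0

/-- The flag quantum minor `[J]_q := [{1,…,|J|} | J]_q`. -/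
noncomputable def flagMinor {K : Type} [Field K] {A : Type} [Ring A] [Algebra K A]
    (q : K) (x : ℕ → ℕ → A) (J : Finset ℕ) : A :=
  qMinor q x (Finset.Icc 1 J.card) J

/-- Manin's relations: `x` is an `m × n` `q`-matrix. -/
def IsQMatrix {K : Type} [Field K] {A : Type} [Ring A] [Algebra K A]
    (q : K) (m n : ℕ) (x : ℕ → ℕ → A) : Prop :=
  (∀ i j k, 1 ≤ i → i ≤ m → 1 ≤ j → j < k → k ≤ n →
    x i j * x i k = q • (x i k * x i j)) ∧
  (∀ i l j, 1 ≤ i → i < l → l ≤ m → 1 ≤ j → j ≤ n →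
    x i j * x l j = q • (x l j * x i j)) ∧
  (∀ i l j k, 1 ≤ i → i < l → l ≤ m → 1 ≤ j → j < k → k ≤ n →
    x i k * x l j = x l j * x i k) ∧
  (∀ i l j k, 1 ≤ i → i < l → l ≤ m → 1 ≤ j → j < k → k ≤ n →
    x i j * x l k - x l k * x i j = (q - q⁻¹) • (x i k * x l j))

/-- `X < Y` elementwise: every element of `X` is smaller than every element of `Y`. -/
def finsetLT (X Y : Finset ℕ) : Prop := ∀ a ∈ X, ∀ b ∈ Y, a < b

/-- One-sided weak separation: `|I| ≥ |J|` and `J - I` has a partition `J₁ ∪ J₂`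
with `J₁ < I - J < J₂`. -/
def WShalf (I J : Finset ℕ) : Prop :=
  J.card ≤ I.card ∧ ∃ J₁ J₂ : Finset ℕ, Disjoint J₁ J₂ ∧ J₁ ∪ J₂ = J \ I ∧
    finsetLT J₁ (I \ J) ∧ finsetLT (I \ J) J₂

/-- `I` and `J` are weakly separated. -/
def WeaklySeparated (I J : Finset ℕ) : Prop := WShalf I J ∨ WShalf J I

/-- `Inv(A,B)`: the number of pairs `(a,b) ∈ A × B` with `a > b`. -/
def invPairs (A B : Finset ℕ) : ℕ := ((A ×ˢ B).filter (fun p => p.2 < p.1)).card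

/-- The quantum determinant of a square array, expanded along the rows in order. -/
noncomputable def qDet {K : Type} [Field K] {A : Type} [Ring A] [Algebra K A]
    (q : K) {k : ℕ} (M : Fin k → Fin k → A) : A :=
  ∑ σ : Equiv.Perm (Fin k),
    ((-q) ^ permInversions σ) • (List.ofFn (fun d => M d (σ d))).prod

section Determinants

variable {K : Type} [Field K] {A B : Type} [Ring A] [Algebra K A] [Ring B] [Algebra K B] {q : K}

theorem qMinor_eq_qDet (x : ℕ → ℕ → A) (I J : Finset ℕ) {k : ℕ} (hI : I.card = k)
    (hJ : J.card = k) :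
    qMinor q x I J =
      qDet q (fun d e : Fin k => x (I.orderEmbOfFin hI d) (J.orderEmbOfFin hJ e)) := by
  subst hI
  simp only [qMinor, qDet, hJ.symm, dite_true]

theorem flagMinor_eq_qDet (x : ℕ → ℕ → A) (J : Finset ℕ) {k : ℕ} (hJ : J.card = k)
    (f : Fin k → ℕ) (hf : StrictMono f) (hfJ : ∀ e, f e ∈ J) :
    flagMinor q x J = qDet q (fun d e : Fin k => x (d + 1) (f e)) := by
  have hI : (Finset.Icc 1 J.card).card = k := by simp [hJ]
  rw [flagMinor, qMinor_eq_qDet x _ _ hI hJ]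
  have h1 : (fun d : Fin k => (d : ℕ) + 1) = (Finset.Icc 1 J.card).orderEmbOfFin hI :=
    Finset.orderEmbOfFin_unique hI
      (fun d => by have := d.isLt; simp only [Finset.mem_Icc]; omega)
      (fun a b h => by simpa using h)
  rw [← Finset.orderEmbOfFin_unique hJ hfJ hf, ← h1]

theorem map_qDet (φ : A →ₐ[K] B) {k : ℕ} (M : Fin k → Fin k → A) :
    φ (qDet q M) = qDet q (fun d e => φ (M d e)) := by
  simp only [qDet, map_sum, map_smul, map_list_prod, List.map_ofFn, Function.comp_def]

theorem map_flagMinor (φ : A →ₐ[K] B) (x : ℕ → ℕ → A) (J : Finset ℕ) :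
    φ (flagMinor q x J) = flagMinor q (fun i j => φ (x i j)) J := by
  have h := fun e => J.orderEmbOfFin_mem rfl e
  rw [flagMinor_eq_qDet x J rfl _ (J.orderEmbOfFin rfl).strictMono h,
    flagMinor_eq_qDet _ J rfl _ (J.orderEmbOfFin rfl).strictMono h, map_qDet]

theorem prod_ofFn_map_mul (L : A →ₐ[K] B) :
    ∀ {k : ℕ} (u : Fin k → A) (g : Fin k → B) (_ : ∀ d v, g d * L v = L v * g d),
      (List.ofFn (fun d => L (u d) * g d)).prod
        = L (List.ofFn u).prod * (List.ofFn g).prod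
  | 0, _, _, _ => by simp
  | k + 1, u, g, hg => by
    simp only [List.ofFn_succ, List.prod_cons, map_mul]
    rw [prod_ofFn_map_mul L (fun d => u d.succ) (fun d => g d.succ) (fun d => hg d.succ)]
    simp only [mul_assoc]
    rw [← mul_assoc (g 0), hg, mul_assoc]

theorem qDet_map_mul (L : A →ₐ[K] B) {k : ℕ} (N : Fin k → Fin k → A) (g : Fin k → B) (G : B)
    (hg : ∀ e v, g e * L v = L v * g e)
    (hG : ∀ σ : Equiv.Perm (Fin k), (List.ofFn (fun d => g (σ d))).prod = G) :
    qDet q (fun d e => L (N d e) * g e) = L (qDet q N) * G := by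
  simp only [qDet, map_sum, Finset.sum_mul, map_smul, smul_mul_assoc]
  refine Finset.sum_congr rfl fun σ _ => ?_
  rw [prod_ofFn_map_mul L (fun d => N d (σ d)) (fun d => g (σ d)) (fun d => hg _), hG]

theorem qDet_add_column {k : ℕ} (M M₁ M₂ : Fin k → Fin k → A) (e₀ : Fin k)
    (h₀ : ∀ d, M d e₀ = M₁ d e₀ + M₂ d e₀)
    (h₁ : ∀ d e, e ≠ e₀ → M d e = M₁ d e) (h₂ : ∀ d e, e ≠ e₀ → M d e = M₂ d e) :
    qDet q M = qDet q M₁ + qDet q M₂ := by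
  simp only [qDet, ← Finset.sum_add_distrib, ← smul_add]
  refine Finset.sum_congr rfl fun σ _ => ?_
  congr 1
  have key : ∀ N : Fin k → Fin k → A, (∀ d e, e ≠ e₀ → M d e = N d e) →
      (fun d => N d (σ d)) =
        Function.update (fun d => M d (σ d)) (σ.symm e₀) (N (σ.symm e₀) e₀) := by
    intro N hN
    funext d
    by_cases hd : d = σ.symm e₀
    · subst hd; simp
    · rw [Function.update_of_ne hd, hN]
      rintro rfl
      simp at hd
  have hM := key M (fun _ _ _ => rfl)
  rw [h₀] at hM
  simp only [← MultilinearMap.mkPiAlgebraFin_apply (R := K)]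
  rw [key M₁ h₁, key M₂ h₂, ← MultilinearMap.map_update_add, ← hM]

theorem prod_ofFn_ite (α : A) :
    ∀ {k : ℕ} (d₀ : Fin k), (List.ofFn (fun d => if d = d₀ then α else 1)).prod = α
  | 0, d₀ => d₀.elim0
  | k + 1, d₀ => by
    rw [List.ofFn_succ, List.prod_cons]
    induction d₀ using Fin.cases with
    | zero => simp [Fin.succ_ne_zero]
    | succ d₀ =>
      simp only [Fin.succ_inj, prod_ofFn_ite α d₀, (Fin.succ_ne_zero d₀).symm, if_false, one_mul]

theorem prod_ofFn_ite_ite (α β : A) :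
    ∀ {k : ℕ} (d₀ d₁ : Fin k), d₀ < d₁ →
      (List.ofFn (fun d => if d = d₀ then α else if d = d₁ then β else 1)).prod = α * β
  | 0, d₀, _, _ => d₀.elim0
  | k + 1, d₀, d₁, h => by
    rw [List.ofFn_succ, List.prod_cons]
    induction d₁ using Fin.cases with
    | zero => simp at h
    | succ d₁ =>
      induction d₀ using Fin.cases with
      | zero => simp [Fin.succ_ne_zero, prod_ofFn_ite β d₁]
      | succ d₀ =>
        simp only [Fin.succ_inj, prod_ofFn_ite_ite α β d₀ d₁ (by simpa using h),
          (Fin.succ_ne_zero d₀).symm, (Fin.succ_ne_zero d₁).symm, if_false, one_mul]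

theorem permInversions_swap_mul {k : ℕ} (σ : Equiv.Perm (Fin k)) (e₀ e₁ : Fin k)
    (he : (e₁ : ℕ) = e₀ + 1) (h : σ.symm e₀ < σ.symm e₁) :
    permInversions (Equiv.swap e₀ e₁ * σ) = permInversions σ + 1 := by
  unfold permInversions
  rw [← Finset.card_insert_of_notMem (a := (σ.symm e₀, σ.symm e₁))]
  · congr 1
    ext ⟨i, j⟩
    simp only [Finset.mem_filter, Finset.mem_univ, true_and, Finset.mem_insert, Prod.mk.injEq,
      Equiv.Perm.mul_apply, Equiv.eq_symm_apply, Equiv.swap_apply_def]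
    have hi : i = σ.symm (σ i) := by simp
    have hj : j = σ.symm (σ j) := by simp
    have hij : σ i = σ j → i = j := fun h => σ.injective h
    by_cases a1 : σ i = e₀ <;> by_cases a2 : σ i = e₁ <;> by_cases a3 : σ j = e₀ <;>
      by_cases a4 : σ j = e₁ <;> simp only [a1, a2, a3, a4] <;>
      grind
  · simp only [Finset.mem_filter, Equiv.apply_symm_apply, not_and]
    intro _ _
    simp only [Fin.lt_def]; omega

theorem qDet_eq_zero_of_columns (L : A →ₐ[K] B) {k : ℕ} (N : Fin k → Fin k → A) (e₀ e₁ : Fin k)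
    (he : (e₁ : ℕ) = e₀ + 1) (hN : ∀ d, N d e₀ = N d e₁) (α β : B)
    (hα : ∀ v, α * L v = L v * α) (hβ : ∀ v, β * L v = L v * β) (h : α * β = q • (β * α)) :
    qDet q (fun d e => L (N d e) * (if e = e₀ then α else if e = e₁ then β else 1)) = 0 := by
  have hne : e₀ ≠ e₁ := by rintro rfl; omega
  set g : Fin k → B := fun e => if e = e₀ then α else if e = e₁ then β else 1 with hg
  have hgL : ∀ e v, g e * L v = L v * g e := by
    intro e v
    simp only [hg]
    split_ifs <;> simp [hα, hβ]
  have hlt : ∀ σ : Equiv.Perm (Fin k), σ.symm e₀ < σ.symm e₁ →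
      (List.ofFn (fun d => g (σ d))).prod = α * β := by
    intro σ hσ
    rw [← prod_ofFn_ite_ite α β _ _ hσ]
    simp only [hg, Equiv.eq_symm_apply]
  have hgt : ∀ σ : Equiv.Perm (Fin k), σ.symm e₁ < σ.symm e₀ →
      (List.ofFn (fun d => g (σ d))).prod = β * α := by
    intro σ hσ
    rw [← prod_ofFn_ite_ite β α _ _ hσ]
    congr 2
    funext d
    simp only [hg, Equiv.eq_symm_apply]
    split_ifs with h1 h2 <;> first | rfl | exact absurd (h1.symm.trans h2) hne
  have hpair : ∀ σ : Equiv.Perm (Fin k), σ.symm e₀ < σ.symm e₁ →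
      ((-q) ^ permInversions σ) • (List.ofFn (fun d => L (N d (σ d)) * g (σ d))).prod +
      ((-q) ^ permInversions (Equiv.swap e₀ e₁ * σ)) •
        (List.ofFn (fun d => L (N d ((Equiv.swap e₀ e₁ * σ) d)) *
          g ((Equiv.swap e₀ e₁ * σ) d))).prod = 0 := by
    intro σ hσ
    have hNσ : ∀ d, N d ((Equiv.swap e₀ e₁ * σ) d) = N d (σ d) := by
      intro d
      simp only [Equiv.Perm.mul_apply, Equiv.swap_apply_def]
      split_ifs with h1 h2
      · rw [h1, hN]
      · rw [h2, hN]
      · rfl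
    rw [permInversions_swap_mul σ e₀ e₁ he hσ,
      prod_ofFn_map_mul L (fun d => N d (σ d)) (fun d => g (σ d)) (fun d => hgL _),
      prod_ofFn_map_mul L (fun d => N d ((Equiv.swap e₀ e₁ * σ) d))
        (fun d => g ((Equiv.swap e₀ e₁ * σ) d)) (fun d => hgL _), hlt σ hσ,
      hgt (Equiv.swap e₀ e₁ * σ) (by
        rw [← Equiv.Perm.inv_def, mul_inv_rev]
        simpa [Equiv.Perm.mul_apply] using hσ), h]
    simp only [hNσ, pow_succ, mul_smul_comm, smul_smul, ← add_smul]
    ring_nf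
    simp
  refine Finset.sum_involution (fun σ _ => Equiv.swap e₀ e₁ * σ) ?_ ?_ ?_ ?_
  · intro σ _
    rcases lt_or_gt_of_ne (fun h => hne (σ.symm.injective h) : σ.symm e₀ ≠ σ.symm e₁) with hσ | hσ
    · exact hpair σ hσ
    · have := hpair (Equiv.swap e₀ e₁ * σ) (by
        rw [← Equiv.Perm.inv_def, mul_inv_rev]
        simpa [Equiv.Perm.mul_apply] using hσ)
      simp only [← mul_assoc, Equiv.swap_mul_self, one_mul] at this
      rw [add_comm]
      exact this
  · intro σ _ _ h'
    have := mul_eq_right.mp h'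
    exact hne (Equiv.swap_eq_one_iff.mp this)
  · intro σ _; exact Finset.mem_univ _
  · intro σ _
    simp only [← mul_assoc, Equiv.swap_mul_self, one_mul]

end Determinants

/-- Replace `k + 1` by `k` in `J` when `k + 1` belongs to `J` and `k` does not. -/
def shiftDown (k : ℕ) (J : Finset ℕ) : Finset ℕ :=
  if k ∉ J ∧ k + 1 ∈ J then insert k (J.erase (k + 1)) else J

theorem card_shiftDown (k : ℕ) (J : Finset ℕ) : (shiftDown k J).card = J.card := by
  unfold shiftDown
  split_ifs with h
  · rw [Finset.card_insert_of_notMem (by simp [h.1]), Finset.card_erase_add_one h.2]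
  · rfl

/-- The matrix `y * z`, where `z` is the identity except for the block `[[a, b], [0, a']]`
in rows and columns `k, k + 1`, and the entries of `y` are transported along `L`. -/
def columnOp {A B : Type} [Mul B] [Add B] (L : A → B) (a a' b : B) (k : ℕ)
    (y : ℕ → ℕ → A) : ℕ → ℕ → B := fun r j =>
  if j = k then L (y r k) * a
  else if j = k + 1 then L (y r k) * b + L (y r (k + 1)) * a'
  else L (y r j)

/-- `[[a, b], [0, a']]` is a `q`-matrix with `a' = a⁻¹` whose entries commute with the image
of `L`. -/
structure IsBorelBlock {K : Type} [Field K] {A B : Type} [Ring A] [Algebra K A] [Ring B]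
    [Algebra K B] (q : K) (L : A →ₐ[K] B) (a a' b : B) : Prop where
  comm_a : ∀ v, a * L v = L v * a
  comm_a' : ∀ v, a' * L v = L v * a'
  comm_b : ∀ v, b * L v = L v * b
  mul_inv : a * a' = 1
  inv_mul : a' * a = 1
  mul_b : a * b = q • (b * a)

namespace IsBorelBlock

variable {K : Type} [Field K] {A B : Type} [Ring A] [Algebra K A] [Ring B] [Algebra K B] {q : K}
  {L : A →ₐ[K] B} {a a' b : B}

theorem b_mul_inv (h : IsBorelBlock q L a a' b) : b * a' = q • (a' * b) := by
  calc b * a' = a' * (a * b) * a' := by rw [← mul_assoc, h.inv_mul, one_mul]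
    _ = q • (a' * b) := by
      rw [h.mul_b, mul_smul_comm, smul_mul_assoc, mul_assoc, mul_assoc, h.mul_inv, mul_one]

theorem map_mul_mul_map_mul (u v : A) {g : B} (hg : ∀ v, g * L v = L v * g) (g' : B) :
    L u * g * (L v * g') = L (u * v) * (g * g') := by
  rw [map_mul, mul_assoc, ← mul_assoc g, hg, mul_assoc, mul_assoc]

section Minors

variable (y : ℕ → ℕ → A) (J : Finset ℕ) (k : ℕ)

theorem flagMinor_columnOp_of_notMem_of_notMem (h₀ : k ∉ J) (h₁ : k + 1 ∉ J) :
    flagMinor q (columnOp L a a' b k y) J = L (flagMinor q y J) := by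
  have hm := fun e => J.orderEmbOfFin_mem rfl e
  rw [flagMinor_eq_qDet _ J rfl _ (J.orderEmbOfFin rfl).strictMono hm,
    flagMinor_eq_qDet _ J rfl _ (J.orderEmbOfFin rfl).strictMono hm, map_qDet]
  congr 1
  funext d e
  rw [columnOp, if_neg (ne_of_mem_of_not_mem (hm e) h₀),
    if_neg (ne_of_mem_of_not_mem (hm e) h₁)]

theorem flagMinor_columnOp_of_mem_of_notMem (h : IsBorelBlock q L a a' b) (h₀ : k ∈ J)
    (h₁ : k + 1 ∉ J) :
    flagMinor q (columnOp L a a' b k y) J = L (flagMinor q y J) * a := by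
  have hm := fun e => J.orderEmbOfFin_mem rfl e
  obtain ⟨e₀, he₀⟩ : ∃ e₀, J.orderEmbOfFin rfl e₀ = k := by
    exact (Set.ext_iff.mp (J.range_orderEmbOfFin rfl) k).mpr h₀
  rw [flagMinor_eq_qDet _ J rfl _ (J.orderEmbOfFin rfl).strictMono hm,
    flagMinor_eq_qDet _ J rfl _ (J.orderEmbOfFin rfl).strictMono hm,
    ← qDet_map_mul L _ (fun e => if e = e₀ then a else 1)]
  · congr 1
    funext d e
    have hiff : J.orderEmbOfFin rfl e = k ↔ e = e₀ := by
      rw [← he₀, (J.orderEmbOfFin rfl).injective.eq_iff]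
    rw [columnOp, if_neg (c := _ = k + 1) (ne_of_mem_of_not_mem (hm e) h₁)]
    simp only [hiff]
    split_ifs with he
    · rw [he, he₀]
    · rw [mul_one]
  · intro e v
    split_ifs <;> simp [h.comm_a]
  · intro σ
    simpa [Equiv.eq_symm_apply] using prod_ofFn_ite a (σ.symm e₀)

theorem flagMinor_columnOp_of_notMem_of_mem (h : IsBorelBlock q L a a' b) (h₀ : k ∉ J)
    (h₁ : k + 1 ∈ J) :
    flagMinor q (columnOp L a a' b k y) J =
      L (flagMinor q y J) * a' + L (flagMinor q y (shiftDown k J)) * b := by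
  have hm := fun e => J.orderEmbOfFin_mem rfl e
  obtain ⟨e₁, he₁⟩ : ∃ e₁, J.orderEmbOfFin rfl e₁ = k + 1 := by
    exact (Set.ext_iff.mp (J.range_orderEmbOfFin rfl) (k + 1)).mpr h₁
  have hiff : ∀ e, J.orderEmbOfFin rfl e = k + 1 ↔ e = e₁ := by
    intro e
    rw [← he₁, (J.orderEmbOfFin rfl).injective.eq_iff]
  have hk : ∀ e, J.orderEmbOfFin rfl e ≠ k := fun e h => h₀ (h ▸ hm e)
  set f : Fin J.card → ℕ := fun e => if e = e₁ then k else J.orderEmbOfFin rfl e with hf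
  have hfm : StrictMono f := by
    intro e e' hee
    have h1 := (J.orderEmbOfFin rfl).strictMono hee
    have h2 := hk e
    have h3 := hk e'
    have h4 := hiff e
    have h5 := hiff e'
    simp only [hf]
    split_ifs with h6 h7 h7
    · omega
    · have := h4.mpr h6; omega
    · have := h5.mpr h7; omega
    · exact h1
  have hfJ : ∀ e, f e ∈ shiftDown k J := by
    intro e
    rw [shiftDown, if_pos ⟨h₀, h₁⟩]
    simp only [hf]
    split_ifs with he
    · simp
    · have := hm e
      have := (hiff e).not.mpr he
      simp_all
  rw [flagMinor_eq_qDet _ J rfl _ (J.orderEmbOfFin rfl).strictMono hm,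
    flagMinor_eq_qDet _ J rfl _ (J.orderEmbOfFin rfl).strictMono hm,
    flagMinor_eq_qDet _ (shiftDown k J) (card_shiftDown k J) f hfm hfJ, add_comm,
    ← qDet_map_mul L _ (fun e => if e = e₁ then b else 1) b,
    ← qDet_map_mul L _ (fun e => if e = e₁ then a' else 1) a']
  · refine qDet_add_column _ _ _ e₁ ?_ ?_ ?_
    · intro d
      simp [columnOp, he₁, hf]
    · intro d e he
      simp [columnOp, hk, hiff, he, hf]
    · intro d e he
      simp [columnOp, hk, hiff, he]
  · intro e v
    split_ifs <;> simp [h.comm_a']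
  · intro σ
    simpa [Equiv.eq_symm_apply] using prod_ofFn_ite a' (σ.symm e₁)
  · intro e v
    split_ifs <;> simp [h.comm_b]
  · intro σ
    simpa [Equiv.eq_symm_apply] using prod_ofFn_ite b (σ.symm e₁)

theorem flagMinor_columnOp_of_mem_of_mem (h : IsBorelBlock q L a a' b) (h₀ : k ∈ J)
    (h₁ : k + 1 ∈ J) :
    flagMinor q (columnOp L a a' b k y) J = L (flagMinor q y J) := by
  have hm := fun e => J.orderEmbOfFin_mem rfl e
  obtain ⟨e₀, he₀⟩ : ∃ e₀, J.orderEmbOfFin rfl e₀ = k := by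
    exact (Set.ext_iff.mp (J.range_orderEmbOfFin rfl) k).mpr h₀
  obtain ⟨e₁, he₁⟩ : ∃ e₁, J.orderEmbOfFin rfl e₁ = k + 1 := by
    exact (Set.ext_iff.mp (J.range_orderEmbOfFin rfl) (k + 1)).mpr h₁
  have hiff₀ : ∀ e, J.orderEmbOfFin rfl e = k ↔ e = e₀ := by
    intro e
    rw [← he₀, (J.orderEmbOfFin rfl).injective.eq_iff]
  have hiff₁ : ∀ e, J.orderEmbOfFin rfl e = k + 1 ↔ e = e₁ := by
    intro e
    rw [← he₁, (J.orderEmbOfFin rfl).injective.eq_iff]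
  have hsucc : (e₁ : ℕ) = e₀ + 1 := by
    have hlt : e₀ < e₁ := by
      rw [← (J.orderEmbOfFin rfl).lt_iff_lt, he₀, he₁]; omega
    by_contra hne
    have hlt' : (e₀ : ℕ) + 1 < e₁ := by have : (e₀ : ℕ) < e₁ := hlt; omega
    have h1 := (J.orderEmbOfFin rfl).strictMono
      (show e₀ < (⟨e₀ + 1, hlt'.trans e₁.isLt⟩ : Fin J.card) by simp [Fin.lt_def])
    have h2 := (J.orderEmbOfFin rfl).strictMono
      (show (⟨e₀ + 1, hlt'.trans e₁.isLt⟩ : Fin J.card) < e₁ from hlt')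
    omega
  have hne : e₁ ≠ e₀ := by rintro rfl; omega
  rw [flagMinor_eq_qDet _ J rfl _ (J.orderEmbOfFin rfl).strictMono hm,
    flagMinor_eq_qDet _ J rfl _ (J.orderEmbOfFin rfl).strictMono hm,
    ← mul_one (L _), ← qDet_map_mul L _ (fun e => if e = e₀ then a else if e = e₁ then a' else 1),
    ← add_zero (qDet q (fun d e => _ * _)),
    ← qDet_eq_zero_of_columns L (fun d e : Fin J.card => y (d + 1)
      (if e = e₁ then k else J.orderEmbOfFin rfl e)) e₀ e₁ hsucc
      (fun d => by simp [he₀]) a b h.comm_a h.comm_b h.mul_b, add_comm]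
  · refine qDet_add_column _ _ _ e₁ ?_ ?_ ?_
    · intro d
      simp [columnOp, he₁, hne]
    · intro d e he
      by_cases h0 : e = e₀
      · subst h0
        simp [columnOp, he₀, he]
      · simp [columnOp, hiff₀, hiff₁, he, h0]
    · intro d e he
      by_cases h0 : e = e₀
      · subst h0
        simp [columnOp, he₀]
      · simp [columnOp, hiff₀, hiff₁, he, h0]
  · intro e v
    split_ifs <;> simp [h.comm_a, h.comm_a']
  · intro σ
    have hσ : σ.symm e₀ ≠ σ.symm e₁ := fun h => hne (σ.symm.injective h).symm
    rcases lt_or_gt_of_ne hσ with hσ | hσ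
    · simpa [Equiv.eq_symm_apply, h.mul_inv] using prod_ofFn_ite_ite a a' _ _ hσ
    · refine Eq.trans ?_ ((prod_ofFn_ite_ite a' a _ _ hσ).trans h.inv_mul)
      congr 2
      funext d
      simp only [Equiv.eq_symm_apply]
      by_cases h0 : σ d = e₀ <;> by_cases h1 : σ d = e₁ <;> simp_all

end Minors

end IsBorelBlock

/-- The relations between the entries of a single column of a `q`-matrix with `m` rows. -/
def ColumnSelfRel {K : Type} [Field K] {A : Type} [Ring A] [Algebra K A] (q : K) (m : ℕ)
    (u : ℕ → A) : Prop :=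
  ∀ i l, 1 ≤ i → i < l → l ≤ m → u i * u l = q • (u l * u i)

/-- The relations between the entries of two distinct columns of a `q`-matrix with `m` rows,
the column `u` standing to the left of the column `v`. -/
def ColumnRel {K : Type} [Field K] {A : Type} [Ring A] [Algebra K A] (q : K) (m : ℕ)
    (u v : ℕ → A) : Prop :=
  (∀ i, 1 ≤ i → i ≤ m → u i * v i = q • (v i * u i)) ∧
  ∀ i l, 1 ≤ i → i < l → l ≤ m →
    v i * u l = u l * v i ∧ u i * v l - v l * u i = (q - q⁻¹) • (v i * u l)

section Columns

variable {K : Type} [Field K] {A B : Type} [Ring A] [Algebra K A] [Ring B] [Algebra K B] {q : K}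
  {m n : ℕ}

theorem isQMatrix_iff_columns (x : ℕ → ℕ → A) :
    IsQMatrix q m n x ↔
      (∀ j, 1 ≤ j → j ≤ n → ColumnSelfRel q m (fun i => x i j)) ∧
      ∀ j k, 1 ≤ j → j < k → k ≤ n → ColumnRel q m (fun i => x i j) (fun i => x i k) := by
  constructor
  · rintro ⟨h1, h2, h3, h4⟩
    exact ⟨fun j hj hjn i l hi hil hl => h2 i l j hi hil hl hj hjn,
      fun j k hj hjk hk => ⟨fun i hi him => h1 i j k hi him hj hjk hk,
        fun i l hi hil hl => ⟨h3 i l j k hi hil hl hj hjk hk, h4 i l j k hi hil hl hj hjk hk⟩⟩⟩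
  · rintro ⟨h1, h2⟩
    exact ⟨fun i j k hi him hj hjk hk => (h2 j k hj hjk hk).1 i hi him,
      fun i l j hi hil hl hj hjn => h1 j hj hjn i l hi hil hl,
      fun i l j k hi hil hl hj hjk hk => ((h2 j k hj hjk hk).2 i l hi hil hl).1,
      fun i l j k hi hil hl hj hjk hk => ((h2 j k hj hjk hk).2 i l hi hil hl).2⟩

theorem ColumnRel.add_left {u₁ u₂ v : ℕ → A} (h₁ : ColumnRel q m u₁ v)
    (h₂ : ColumnRel q m u₂ v) : ColumnRel q m (fun i => u₁ i + u₂ i) v := by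
  refine ⟨fun i hi him => ?_, fun i l hi hil hl => ⟨?_, ?_⟩⟩
  · rw [add_mul, h₁.1 i hi him, h₂.1 i hi him, mul_add, smul_add]
  · rw [mul_add, (h₁.2 i l hi hil hl).1, (h₂.2 i l hi hil hl).1, add_mul]
  · simp only [mul_add, smul_add, add_mul]
    rw [← (h₁.2 i l hi hil hl).2, ← (h₂.2 i l hi hil hl).2]
    abel

theorem ColumnRel.add_right {u v₁ v₂ : ℕ → A} (h₁ : ColumnRel q m u v₁)
    (h₂ : ColumnRel q m u v₂) : ColumnRel q m u (fun i => v₁ i + v₂ i) := by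
  refine ⟨fun i hi him => ?_, fun i l hi hil hl => ⟨?_, ?_⟩⟩
  · rw [mul_add, h₁.1 i hi him, h₂.1 i hi him, add_mul, smul_add]
  · rw [add_mul, (h₁.2 i l hi hil hl).1, (h₂.2 i l hi hil hl).1, mul_add]
  · simp only [mul_add, smul_add, add_mul]
    rw [← (h₁.2 i l hi hil hl).2, ← (h₂.2 i l hi hil hl).2]
    abel

variable {L : A →ₐ[K] B}

theorem ColumnRel.map_mul {u v : ℕ → A} (h : ColumnRel q m u v) {α β : B}
    (hα : ∀ v, α * L v = L v * α) (hβ : ∀ v, β * L v = L v * β) (hαβ : α * β = β * α) :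
    ColumnRel q m (fun i => L (u i) * α) (fun i => L (v i) * β) := by
  refine ⟨fun i hi him => ?_, fun i l hi hil hl => ⟨?_, ?_⟩⟩ <;>
    simp only [IsBorelBlock.map_mul_mul_map_mul _ _ hα, IsBorelBlock.map_mul_mul_map_mul _ _ hβ,
      hαβ, ← sub_mul, ← map_sub]
  · rw [h.1 i hi him, map_smul, smul_mul_assoc]
  · rw [(h.2 i l hi hil hl).1]
  · rw [(h.2 i l hi hil hl).2, map_smul, smul_mul_assoc]

theorem ColumnSelfRel.map_mul {u : ℕ → A} (h : ColumnSelfRel q m u) {α : B}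
    (hα : ∀ v, α * L v = L v * α) : ColumnSelfRel q m (fun i => L (u i) * α) := by
  intro i l hi hil hl
  simp only [IsBorelBlock.map_mul_mul_map_mul _ _ hα]
  rw [h i l hi hil hl, map_smul, smul_mul_assoc]

namespace IsBorelBlock

variable {a a' b : B}

theorem columnRel_duplicate (hL : IsBorelBlock q L a a' b) (hq : q ≠ 0) {u : ℕ → A}
    (h : ColumnSelfRel q m u) :
    ColumnRel q m (fun i => L (u i) * a) (fun i => L (u i) * b) := by
  refine ⟨fun i hi him => ?_, fun i l hi hil hl => ⟨?_, ?_⟩⟩ <;>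
    simp only [map_mul_mul_map_mul _ _ hL.comm_a, map_mul_mul_map_mul _ _ hL.comm_b, hL.mul_b,
      mul_smul_comm]
  · rw [h i l hi hil hl, map_smul, smul_mul_assoc]
  · rw [h i l hi hil hl, map_smul, smul_mul_assoc, smul_smul, smul_smul]
    match_scalars
    field_simp

theorem columnSelfRel_add (hL : IsBorelBlock q L a a' b) (hq : q ≠ 0) {u v : ℕ → A}
    (hu : ColumnSelfRel q m u) (hv : ColumnSelfRel q m v) (huv : ColumnRel q m u v) :
    ColumnSelfRel q m (fun i => L (u i) * b + L (v i) * a') := by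
  intro i l hi hil hl
  have h1 := (huv.2 i l hi hil hl).1
  have h2 : u i * v l = v l * u i + (q - q⁻¹) • (u l * v i) := by
    rw [← h1, ← (huv.2 i l hi hil hl).2]; abel
  simp only [add_mul, mul_add, map_mul_mul_map_mul _ _ hL.comm_a',
    map_mul_mul_map_mul _ _ hL.comm_b, hL.b_mul_inv]
  rw [hu i l hi hil hl, hv i l hi hil hl, h1, h2]
  simp only [map_smul, map_add, add_mul, mul_smul_comm, smul_mul_assoc]
  match_scalars <;> field_simp
  ring

theorem isQMatrix_columnOp (hL : IsBorelBlock q L a a' b) (hq : q ≠ 0) {y : ℕ → ℕ → A}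
    (hy : IsQMatrix q m n y) {k : ℕ} (hk : 1 ≤ k) (hkn : k + 1 ≤ n) :
    IsQMatrix q m n (columnOp L a a' b k y) := by
  rw [isQMatrix_iff_columns] at hy ⊢
  obtain ⟨hs, hr⟩ := hy
  have hone : ∀ v, (1 : B) * L v = L v * 1 := fun v => by simp
  have c0 : (fun i => columnOp L a a' b k y i k) = fun i => L (y i k) * a := by
    simp [columnOp]
  have c1 : (fun i => columnOp L a a' b k y i (k + 1)) =
      fun i => L (y i k) * b + L (y i (k + 1)) * a' := by
    simp [columnOp]
  have c2 : ∀ j, j ≠ k → j ≠ k + 1 →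
      (fun i => columnOp L a a' b k y i j) = fun i => L (y i j) * 1 := by
    intro j h0 h1
    simp [columnOp, h0, h1]
  constructor
  · intro j hj hjn
    by_cases h0 : j = k
    · subst h0; rw [c0]; exact (hs j hj hjn).map_mul hL.comm_a
    by_cases h1 : j = k + 1
    · subst h1; rw [c1]
      exact hL.columnSelfRel_add hq (hs k hk (by omega)) (hs _ hj hjn)
        (hr k (k + 1) hk (by omega) hkn)
    rw [c2 j h0 h1]
    exact (hs j hj hjn).map_mul hone
  · intro i j hi hij hj
    by_cases h0 : i = k
    · subst h0
      rw [c0]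
      by_cases h1 : j = i + 1
      · subst h1
        rw [c1]
        exact (hL.columnRel_duplicate hq (hs i hi (by omega))).add_right
          ((hr i (i + 1) hi hij hj).map_mul hL.comm_a hL.comm_a'
            (by rw [hL.mul_inv, hL.inv_mul]))
      · rw [c2 j (by omega) h1]
        exact (hr i j hi hij hj).map_mul hL.comm_a hone (by simp)
    by_cases h1 : i = k + 1
    · subst h1
      rw [c1, c2 j (by omega) (by omega)]
      exact ((hr k j hk (by omega) hj).map_mul hL.comm_b hone (by simp)).add_left
        ((hr (k + 1) j hi hij hj).map_mul hL.comm_a' hone (by simp))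
    rw [c2 i h0 h1]
    by_cases h2 : j = k
    · subst h2
      rw [c0]
      exact (hr i j hi hij hj).map_mul hone hL.comm_a (by simp)
    by_cases h3 : j = k + 1
    · subst h3
      rw [c1]
      exact ((hr i k hi (by omega) (by omega)).map_mul hone hL.comm_b (by simp)).add_right
        ((hr i (k + 1) hi hij hj).map_mul hone hL.comm_a' (by simp))
    rw [c2 j h2 h3]
    exact (hr i j hi hij hj).map_mul hone hone rfl

end IsBorelBlock

end Columns

section BorelModel

variable {K : Type} [Field K] {A : Type} [Ring A] [Algebra K A]

/-- The action of `A` on sequences by termwise left multiplication. -/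
noncomputable def constMul (K : Type) [Field K] (A : Type) [Ring A] [Algebra K A] :
    A →ₐ[K] Module.End K (ℤ → A) :=
  (Algebra.lmul K (ℤ → A)).comp (Pi.constAlgHom K ℤ A)

/-- Multiplication of the term of index `t` of a sequence by `(q ^ s) ^ t`. -/
noncomputable def gradingScale (q : K) (s : ℤ) : Module.End K (ℤ → A) :=
  LinearMap.pi fun t => q ^ (s * t) • LinearMap.proj t

/-- The shift of sequences by one step to the right. -/
noncomputable def rightShift (K : Type) [Field K] (A : Type) [Ring A] [Algebra K A] :
    Module.End K (ℤ → A) :=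
  LinearMap.pi fun t => LinearMap.proj (t - 1)

@[simp]
theorem constMul_apply (u : A) (f : ℤ → A) (t : ℤ) : constMul K A u f t = u * f t := by
  simp [constMul]

@[simp]
theorem gradingScale_apply (q : K) (s : ℤ) (f : ℤ → A) (t : ℤ) :
    gradingScale q s f t = q ^ (s * t) • f t := by
  simp [gradingScale]

@[simp]
theorem rightShift_apply (f : ℤ → A) (t : ℤ) : rightShift K A f t = f (t - 1) := by
  simp [rightShift]

theorem isBorelBlock_model {q : K} (hq : q ≠ 0) :
    IsBorelBlock q (constMul K A) (gradingScale q 1) (gradingScale q (-1)) (rightShift K A) where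
  comm_a v := by ext f t; simp
  comm_a' v := by ext f t; simp
  comm_b v := by ext f t; simp
  mul_inv := by ext f t; simp [smul_smul, zpow_ne_zero _ hq]
  inv_mul := by ext f t; simp [smul_smul, zpow_ne_zero _ hq]
  mul_b := by
    ext f t
    simp only [Module.End.mul_apply, gradingScale_apply, rightShift_apply, LinearMap.smul_apply,
      Pi.smul_apply, smul_smul]
    rw [← zpow_one_add₀ hq]
    congr 2
    ring

end BorelModel

/-- Some `q`-matrix excludes every quasicommutation relation between `[I]` and `[J]` except
possibly the one with exponent `c`. -/
def ExcludesAllBut {K : Type} [Field K] (q : K) (m n : ℕ) (I J : Finset ℕ) (c : ℤ) : Prop :=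
  ∃ (A : Type) (_ : Ring A) (_ : Algebra K A) (x : ℕ → ℕ → A), IsQMatrix q m n x ∧
    ∀ d : ℤ, flagMinor q x I * flagMinor q x J =
      (q ^ d) • (flagMinor q x J * flagMinor q x I) → d = c

/-- The exponent contributed by the two columns `k` and `k + 1` when passing from `I, J` to
`shiftDown k I, shiftDown k J`. -/
def shiftExponent (k : ℕ) (I J : Finset ℕ) : ℤ :=
  if (k ∈ I ∧ k + 1 ∉ I) ∧ (k ∉ J ∧ k + 1 ∈ J) then 1
  else if (k ∉ I ∧ k + 1 ∈ I) ∧ (k ∈ J ∧ k + 1 ∉ J) then -1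
  else 0

namespace ExcludesAllBut

variable {K : Type} [Field K] {q : K} {m n : ℕ} {I J : Finset ℕ}

theorem flagMinor_columnOp_model {A : Type} [Ring A] [Algebra K A] (hq : q ≠ 0)
    (y : ℕ → ℕ → A) (k : ℕ) (J : Finset ℕ) :
    let X := flagMinor q (columnOp (constMul K A) (gradingScale q 1) (gradingScale q (-1))
      (rightShift K A) k y) J
    let U := constMul K A (flagMinor q y (shiftDown k J))
    (¬ (k ∈ J ∧ k + 1 ∉ J) ∧ ¬ (k ∉ J ∧ k + 1 ∈ J) ∧ X = U) ∨
    ((k ∈ J ∧ k + 1 ∉ J) ∧ ¬ (k ∉ J ∧ k + 1 ∈ J) ∧ X = U * gradingScale q 1) ∨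
    (¬ (k ∈ J ∧ k + 1 ∉ J) ∧ (k ∉ J ∧ k + 1 ∈ J) ∧
      ∃ w, X = constMul K A w * gradingScale q (-1) + U * rightShift K A) := by
  have hL := isBorelBlock_model (A := A) hq
  by_cases h0 : k ∈ J <;> by_cases h1 : k + 1 ∈ J
  · refine Or.inl ⟨by tauto, by tauto, ?_⟩
    rw [hL.flagMinor_columnOp_of_mem_of_mem y J k h0 h1, shiftDown, if_neg (by tauto)]
  · refine Or.inr (Or.inl ⟨by tauto, by tauto, ?_⟩)
    rw [hL.flagMinor_columnOp_of_mem_of_notMem y J k h0 h1, shiftDown, if_neg (by tauto)]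
  · exact Or.inr (Or.inr ⟨by tauto, by tauto, _,
      hL.flagMinor_columnOp_of_notMem_of_mem y J k h0 h1⟩)
  · refine Or.inl ⟨by tauto, by tauto, ?_⟩
    rw [IsBorelBlock.flagMinor_columnOp_of_notMem_of_notMem y J k h0 h1, shiftDown,
      if_neg (by tauto)]

theorem of_shiftDown (hq : q ≠ 0) {k : ℕ} (hk : 1 ≤ k) (hkn : k + 1 ≤ n) {c : ℤ}
    (h : ExcludesAllBut q m n (shiftDown k I) (shiftDown k J) c) :
    ExcludesAllBut q m n I J (c + shiftExponent k I J) := by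
  obtain ⟨A, _, _, y, hy, hc⟩ := h
  refine ⟨Module.End K (ℤ → A), inferInstance, inferInstance, _,
    (isBorelBlock_model hq).isQMatrix_columnOp hq hy hk hkn, fun d hd => ?_⟩
  suffices flagMinor q y (shiftDown k I) * flagMinor q y (shiftDown k J) =
      q ^ (d - shiftExponent k I J) •
        (flagMinor q y (shiftDown k J) * flagMinor q y (shiftDown k I)) by
    have := hc _ this
    omega
  have hcoef := fun t => congrFun (LinearMap.congr_fun hd (Pi.single 0 1)) t
  unfold shiftExponent
  rcases flagMinor_columnOp_model hq y k I with
      ⟨hI, hI', eI⟩ | ⟨hI, hI', eI⟩ | ⟨hI, hI', w, eI⟩ <;>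
    rcases flagMinor_columnOp_model hq y k J with
      ⟨hJ, hJ', eJ⟩ | ⟨hJ, hJ', eJ⟩ | ⟨hJ, hJ', w', eJ⟩ <;>
    simp only [hI, hI', hJ, hJ', and_self, and_true, and_false, if_false, sub_zero] <;>
    simp only [eI, eJ, Module.End.mul_apply, LinearMap.add_apply, LinearMap.smul_apply,
      Pi.add_apply, Pi.smul_apply, constMul_apply, gradingScale_apply, rightShift_apply] at hcoef
  · simpa using hcoef 0
  · simpa using hcoef 0
  · simpa using hcoef 1
  · simpa using hcoef 0
  · simpa using hcoef 0
  · rw [if_pos (by simp), zpow_sub_one₀ hq, mul_comm (q ^ d), mul_smul, eq_inv_smul_iff₀ hq]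
    simpa using hcoef 1
  · simpa using hcoef 1
  · rw [if_pos (by simp), sub_neg_eq_add, zpow_add_one₀ hq, mul_smul]
    simpa using hcoef 1
  · simpa [Pi.single_apply] using hcoef 2

end ExcludesAllBut

theorem qDet_one {K : Type} [Field K] (q : K) (k : ℕ) :
    qDet q (fun d e : Fin k => if d = e then (1 : K) else 0) = 1 := by
  rw [qDet, Finset.sum_eq_single 1]
  · have : permInversions (1 : Equiv.Perm (Fin k)) = 0 := by
      rw [permInversions, Finset.card_eq_zero, Finset.filter_eq_empty_iff]
      rintro ⟨i, j⟩ -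
      simpa using fun h : i < j => h.le
    simp [this]
  · intro σ _ hσ
    obtain ⟨d, hd⟩ : ∃ d, σ d ≠ d := by
      by_contra! h
      exact hσ (Equiv.ext h)
    rw [List.prod_eq_zero, smul_zero]
    rw [List.mem_ofFn]
    exact ⟨d, if_neg hd.symm⟩
  · simp

theorem flagMinor_one {K : Type} [Field K] (q : K) (a : ℕ) :
    flagMinor q (fun i j => if i = j then (1 : K) else 0) (Finset.Icc 1 a) = 1 := by
  rw [flagMinor_eq_qDet _ _ (by simp : (Finset.Icc 1 a).card = a) (fun e => (e : ℕ) + 1)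
    (fun i j h => by simpa using h) (fun e => by have := e.isLt; simp only [Finset.mem_Icc]; omega)]
  simpa [Fin.ext_iff] using qDet_one q a

namespace ExcludesAllBut

variable {K : Type} [Field K] {q : K} {m n : ℕ} {I J : Finset ℕ}

theorem Icc_Icc (hroot : ∀ d : ℤ, q ^ d = 1 → d = 0) (a b : ℕ) :
    ExcludesAllBut q m n (Finset.Icc 1 a) (Finset.Icc 1 b) 0 := by
  refine ⟨K, inferInstance, inferInstance, fun i j => if i = j then 1 else 0,
    ⟨?_, ?_, ?_, ?_⟩, fun d hd => ?_⟩
  · intro i j k _ _ _ hjk _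
    dsimp only
    split_ifs <;> first | omega | simp
  · intro i l j _ hil _ _ _
    dsimp only
    split_ifs <;> first | omega | simp
  · intro i l j k _ _ _ _ _ _
    exact mul_comm _ _
  · intro i l j k _ hil _ _ hjk _
    dsimp only
    split_ifs <;> first | omega | simp
  · rw [flagMinor_one, flagMinor_one] at hd
    exact hroot d (by simpa using hd.symm)

theorem swap (hq : q ≠ 0) {c : ℤ} (h : ExcludesAllBut q m n I J c) :
    ExcludesAllBut q m n J I (-c) := by
  obtain ⟨A, _, _, x, hx, hc⟩ := h
  refine ⟨A, inferInstance, inferInstance, x, hx, fun d hd => ?_⟩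
  have := hc (-d) (by rw [hd, smul_smul, ← zpow_add₀ hq]; simp)
  omega

theorem exists_not_quasicommuting {c₁ c₂ : ℤ} (h₁ : ExcludesAllBut q m n I J c₁)
    (h₂ : ExcludesAllBut q m n I J c₂) (hne : c₁ ≠ c₂) :
    ∃ (A : Type) (_ : Ring A) (_ : Algebra K A) (x : ℕ → ℕ → A), IsQMatrix q m n x ∧
      ∀ c : ℤ, flagMinor q x I * flagMinor q x J ≠
        (q ^ c) • (flagMinor q x J * flagMinor q x I) := by
  obtain ⟨A₁, _, _, x₁, ⟨r₁, r₂, r₃, r₄⟩, hc₁⟩ := h₁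
  obtain ⟨A₂, _, _, x₂, ⟨s₁, s₂, s₃, s₄⟩, hc₂⟩ := h₂
  refine ⟨A₁ × A₂, inferInstance, inferInstance, fun i j => (x₁ i j, x₂ i j),
    ⟨?_, ?_, ?_, ?_⟩, fun c hc => hne ?_⟩
  · exact fun i j k h h' h'' h₃ h₄ => Prod.ext (r₁ i j k h h' h'' h₃ h₄) (s₁ i j k h h' h'' h₃ h₄)
  · exact fun i j k h h' h'' h₃ h₄ => Prod.ext (r₂ i j k h h' h'' h₃ h₄) (s₂ i j k h h' h'' h₃ h₄)
  · exact fun i l j k h h' h'' h₃ h₄ h₅ =>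
      Prod.ext (r₃ i l j k h h' h'' h₃ h₄ h₅) (s₃ i l j k h h' h'' h₃ h₄ h₅)
  · exact fun i l j k h h' h'' h₃ h₄ h₅ =>
      Prod.ext (r₄ i l j k h h' h'' h₃ h₄ h₅) (s₄ i l j k h h' h'' h₃ h₄ h₅)
  · have e₁ := congrArg (AlgHom.fst K A₁ A₂) hc
    have e₂ := congrArg (AlgHom.snd K A₁ A₂) hc
    simp only [map_mul, map_smul, map_flagMinor, AlgHom.fst_apply, AlgHom.snd_apply] at e₁ e₂
    rw [← hc₁ c e₁, ← hc₂ c e₂]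

end ExcludesAllBut

/-- The number of elements of `S` that are at most `t`. -/
def countLE (S : Finset ℕ) (t : ℕ) : ℕ := (S.filter (· ≤ t)).card

section Combinatorics

variable {n : ℕ} {I J : Finset ℕ}

theorem mem_shiftDown_iff (k : ℕ) (J : Finset ℕ) (j : ℕ) :
    j ∈ shiftDown k J ↔
      (j ≠ k ∧ j ≠ k + 1 ∧ j ∈ J) ∨ (j = k ∧ (k ∈ J ∨ k + 1 ∈ J)) ∨
        (j = k + 1 ∧ k ∈ J ∧ k + 1 ∈ J) := by
  unfold shiftDown
  split_ifs with h
  · simp only [Finset.mem_insert, Finset.mem_erase]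
    grind
  · grind

theorem shiftDown_subset_Icc {k : ℕ} (hk : 1 ≤ k) (hkn : k + 1 ≤ n) (hJ : J ⊆ Finset.Icc 1 n) :
    shiftDown k J ⊆ Finset.Icc 1 n := by
  intro j hj
  rw [mem_shiftDown_iff] at hj
  rcases hj with ⟨-, -, h⟩ | ⟨rfl, -⟩ | ⟨rfl, -⟩
  · exact hJ h
  · simp only [Finset.mem_Icc]; omega
  · simp only [Finset.mem_Icc]; omega

theorem sum_shiftDown (k : ℕ) (J : Finset ℕ) :
    ∑ j ∈ shiftDown k J, j + (if k ∉ J ∧ k + 1 ∈ J then 1 else 0) = ∑ j ∈ J, j := by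
  unfold shiftDown
  split_ifs with h
  · rw [Finset.sum_insert (by simp [h.1]), ← Finset.add_sum_erase J _ h.2]
    omega
  · rfl

theorem card_eq_card_erase_erase (S : Finset ℕ) (k : ℕ) :
    S.card = ((S.erase k).erase (k + 1)).card + (if k ∈ S then 1 else 0) +
      (if k + 1 ∈ S then 1 else 0) := by
  have h1 := Finset.card_erase_add_one (s := S) (a := k)
  have h2 := Finset.card_erase_add_one (s := S.erase k) (a := k + 1)
  have h3 := Finset.erase_eq_of_notMem (s := S) (a := k)
  have h4 := Finset.erase_eq_of_notMem (s := S.erase k) (a := k + 1)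
  simp only [Finset.mem_erase] at h2 h4
  grind

theorem card_shiftDown_sdiff (k : ℕ) (I J : Finset ℕ) :
    (shiftDown k J \ shiftDown k I).card +
        (if shiftExponent k I J = 0 then 0 else 1) = (J \ I).card := by
  rw [card_eq_card_erase_erase (shiftDown k J \ shiftDown k I) k,
    card_eq_card_erase_erase (J \ I) k]
  have : ((shiftDown k J \ shiftDown k I).erase k).erase (k + 1) =
      ((J \ I).erase k).erase (k + 1) := by
    ext j
    simp only [Finset.mem_erase, Finset.mem_sdiff, mem_shiftDown_iff]
    grind
  rw [this]
  unfold shiftExponent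
  simp only [Finset.mem_sdiff, mem_shiftDown_iff]
  by_cases h1 : k ∈ I <;> by_cases h2 : k + 1 ∈ I <;> by_cases h3 : k ∈ J <;>
    by_cases h4 : k + 1 ∈ J <;> simp [h1, h2, h3, h4]

theorem countLE_succ (S : Finset ℕ) (t : ℕ) :
    countLE S (t + 1) = countLE S t + if t + 1 ∈ S then 1 else 0 := by
  unfold countLE
  have : S.filter (· ≤ t + 1) = S.filter (· ≤ t) ∪ S.filter (· = t + 1) := by
    ext; simp only [Finset.mem_filter, Finset.mem_union]; grind
  rw [this, Finset.card_union_of_disjoint, Finset.filter_eq']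
  · split_ifs <;> simp
  · rw [Finset.disjoint_filter]; intros; omega

theorem countLE_shiftDown (k : ℕ) (J : Finset ℕ) (t : ℕ) :
    countLE (shiftDown k J) t =
      countLE J t + if t = k ∧ k ∉ J ∧ k + 1 ∈ J then 1 else 0 := by
  unfold countLE
  rw [card_eq_card_erase_erase ((shiftDown k J).filter (· ≤ t)) k,
    card_eq_card_erase_erase (J.filter (· ≤ t)) k]
  have : (((shiftDown k J).filter (· ≤ t)).erase k).erase (k + 1) =
      ((J.filter (· ≤ t)).erase k).erase (k + 1) := by
    ext j
    simp only [Finset.mem_erase, Finset.mem_filter, mem_shiftDown_iff]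
    grind
  rw [this]
  simp only [Finset.mem_filter, mem_shiftDown_iff]
  grind

theorem countLE_shiftDown_sub_le {k : ℕ} (hk : 1 ≤ k) {p : ℤ}
    (hp : ∀ t, (countLE J t : ℤ) - countLE I t ≤ p) (t : ℕ) :
    (countLE (shiftDown k J) t : ℤ) - countLE (shiftDown k I) t ≤ p := by
  obtain ⟨k, rfl⟩ := Nat.exists_eq_add_of_le' hk
  have h0 := hp k
  have h1 := hp (k + 1)
  have h2 := hp (k + 1 + 1)
  rw [countLE_shiftDown, countLE_shiftDown]
  by_cases ht : t = k + 1
  · subst ht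
    simp only [countLE_succ _ (k + 1), countLE_succ _ k] at h0 h1 h2 ⊢
    by_cases a1 : k + 1 ∈ I <;> by_cases a2 : k + 1 + 1 ∈ I <;> by_cases a3 : k + 1 ∈ J <;>
      by_cases a4 : k + 1 + 1 ∈ J <;> simp [a1, a2, a3, a4] at h0 h1 h2 ⊢ <;> omega
  · simpa [ht] using hp t

theorem countLE_sub_le_card_sdiff (I J : Finset ℕ) (t : ℕ) :
    (countLE J t : ℤ) - countLE I t ≤ (J \ I).card := by
  have : (J.filter (· ≤ t)) ⊆ I.filter (· ≤ t) ∪ (J \ I) := by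
    intro j
    simp only [Finset.mem_filter, Finset.mem_union, Finset.mem_sdiff]
    tauto
  have := (Finset.card_le_card this).trans (Finset.card_union_le _ _)
  unfold countLE
  omega

theorem countLE_zero (hJ : J ⊆ Finset.Icc 1 n) : countLE J 0 = 0 := by
  rw [countLE, Finset.card_eq_zero, Finset.filter_eq_empty_iff]
  intro j hj
  have := Finset.mem_Icc.mp (hJ hj)
  omega

theorem countLE_of_le (hJ : J ⊆ Finset.Icc 1 n) {t : ℕ} (ht : n ≤ t) : countLE J t = J.card := by
  rw [countLE, Finset.filter_true_of_mem]
  intro j hj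
  have := Finset.mem_Icc.mp (hJ hj)
  omega

theorem mem_of_le_of_pred_closed (h : ∀ k, 1 ≤ k → k + 1 ∈ J → k ∈ J) {i j : ℕ} (hi : 1 ≤ i)
    (hij : i ≤ j) (hj : j ∈ J) : i ∈ J := by
  induction j, hij using Nat.le_induction with
  | base => exact hj
  | succ j hij ih => exact ih (h j (hi.trans hij) hj)

theorem eq_Icc_of_pred_closed (hJ : J ⊆ Finset.Icc 1 n)
    (h : ∀ k, 1 ≤ k → k + 1 ∈ J → k ∈ J) : J = Finset.Icc 1 J.card := by
  rcases J.eq_empty_or_nonempty with rfl | hne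
  · simp
  · have key : J = Finset.Icc 1 (J.max' hne) := by
      ext j
      rw [Finset.mem_Icc]
      exact ⟨fun hj => ⟨(Finset.mem_Icc.mp (hJ hj)).1, J.le_max' j hj⟩,
        fun hj => mem_of_le_of_pred_closed h hj.1 hj.2 (J.max'_mem hne)⟩
    have hc := congrArg Finset.card key
    rw [Nat.card_Icc, Nat.add_sub_cancel] at hc
    rw [hc]
    exact key

end Combinatorics

theorem ExcludesAllBut.exists_ge {K : Type} [Field K] {q : K} {m n : ℕ} (hq : q ≠ 0)
    (hroot : ∀ d : ℤ, q ^ d = 1 → d = 0) (I J : Finset ℕ)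
    (hI : I ⊆ Finset.Icc 1 n) (hJ : J ⊆ Finset.Icc 1 n) (p : ℤ)
    (hp : ∀ t, (countLE J t : ℤ) - countLE I t ≤ p) :
    ∃ c, ExcludesAllBut q m n I J c ∧
      ((J \ I).card : ℤ) - 2 * p + max ((J.card : ℤ) - I.card) 0 ≤ c := by
  induction hN : ∑ i ∈ I, i + ∑ j ∈ J, j using Nat.strong_induction_on generalizing I J p with
  | _ N ih =>
  have step : ∀ k, 1 ≤ k → k + 1 ≤ n → (k ∉ I ∧ k + 1 ∈ I) ∨ (k ∉ J ∧ k + 1 ∈ J) →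
      ∀ p : ℤ, (∀ t, (countLE (shiftDown k J) t : ℤ) - countLE (shiftDown k I) t ≤ p) →
      ∃ c, ExcludesAllBut q m n I J (c + shiftExponent k I J) ∧
        ((shiftDown k J \ shiftDown k I).card : ℤ) - 2 * p + max ((J.card : ℤ) - I.card) 0 ≤ c := by
    intro k hk hkn hmove p hp
    have hlt : ∑ i ∈ shiftDown k I, i + ∑ j ∈ shiftDown k J, j < N := by
      have h1 := sum_shiftDown k I
      have h2 := sum_shiftDown k J
      rcases hmove with h | h
      · rw [if_pos h] at h1; omega
      · rw [if_pos h] at h2; omega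
    obtain ⟨c, hc, hle⟩ := ih _ hlt _ _ (shiftDown_subset_Icc hk hkn hI)
      (shiftDown_subset_Icc hk hkn hJ) p hp rfl
    rw [card_shiftDown, card_shiftDown] at hle
    exact ⟨c, hc.of_shiftDown hq hk hkn, hle⟩
  by_cases h1 : ∃ k, 1 ≤ k ∧ k + 1 ≤ n ∧ ((k ∉ I ∧ k + 1 ∈ I) ∨ (k ∉ J ∧ k + 1 ∈ J)) ∧
      ¬ ((k ∉ I ∧ k + 1 ∈ I) ∧ (k ∈ J ∧ k + 1 ∉ J))
  · obtain ⟨k, hk, hkn, hmove, hnot⟩ := h1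
    obtain ⟨c, hc, hle⟩ := step k hk hkn hmove p (countLE_shiftDown_sub_le hk hp)
    refine ⟨_, hc, ?_⟩
    have := card_shiftDown_sdiff k I J
    unfold shiftExponent at this ⊢
    rw [if_neg hnot] at this ⊢
    split_ifs at this ⊢ <;> omega
  have hJc : ∀ k, 1 ≤ k → k + 1 ∈ J → k ∈ J := by
    intro k hk hkJ
    by_contra hkJ'
    exact h1 ⟨k, hk, (Finset.mem_Icc.mp (hJ hkJ)).2, Or.inr ⟨hkJ', hkJ⟩, fun h => hkJ' h.2.1⟩
  by_cases h2 : ∃ k, 1 ≤ k ∧ k + 1 ≤ n ∧ (k ∉ I ∧ k + 1 ∈ I) ∧ (k ∈ J ∧ k + 1 ∉ J)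
  · obtain ⟨k, hk, hkn, hkI, hkJ⟩ := h2
    obtain ⟨c, hc, hle⟩ := step k hk hkn (Or.inl hkI) _ (countLE_sub_le_card_sdiff _ _)
    refine ⟨_, hc, ?_⟩
    have hexp : shiftExponent k I J = -1 := by
      rw [shiftExponent, if_neg (by tauto), if_pos ⟨hkI, hkJ⟩]
    have hcard := card_shiftDown_sdiff k I J
    have hpk := hp k
    have hsub : I.filter (· ≤ k) ∪ (J \ I) ⊆ J.filter (· ≤ k) := by
      intro j
      simp only [Finset.mem_filter, Finset.mem_union, Finset.mem_sdiff]
      rintro (⟨hj, hjk⟩ | ⟨hj, -⟩)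
      · exact ⟨mem_of_le_of_pred_closed hJc (Finset.mem_Icc.mp (hI hj)).1 hjk hkJ.1, hjk⟩
      · refine ⟨hj, ?_⟩
        by_contra hlt
        exact hkJ.2 (mem_of_le_of_pred_closed hJc (by omega) (by omega) hj)
    have hle' := Finset.card_le_card hsub
    rw [Finset.card_union_of_disjoint
      (Finset.disjoint_sdiff.mono_left (Finset.filter_subset _ _))] at hle'
    rw [hexp] at hcard ⊢
    unfold countLE at hpk
    simp only [show (-1 : ℤ) ≠ 0 by decide, if_false] at hcard
    omega
  have hIc : ∀ k, 1 ≤ k → k + 1 ∈ I → k ∈ I := by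
    intro k hk hkI
    by_contra hkI'
    have hkn := (Finset.mem_Icc.mp (hI hkI)).2
    by_cases h : k ∈ J ∧ k + 1 ∉ J
    · exact h2 ⟨k, hk, hkn, ⟨hkI', hkI⟩, h⟩
    · exact h1 ⟨k, hk, hkn, Or.inl ⟨hkI', hkI⟩, fun h' => h h'.2⟩
  have eI := eq_Icc_of_pred_closed hI hIc
  have eJ := eq_Icc_of_pred_closed hJ hJc
  refine ⟨0, ?_, ?_⟩
  · rw [eI, eJ]
    exact Icc_Icc hroot _ _
  · have hsd : J \ I = Finset.Icc (I.card + 1) J.card := by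
      rw [eI, eJ]
      ext j
      simp only [Finset.mem_sdiff, Finset.mem_Icc, Nat.card_Icc]
      omega
    have h0 := hp 0
    have hn := hp n
    rw [countLE_zero hI, countLE_zero hJ] at h0
    rw [countLE_of_le hI le_rfl, countLE_of_le hJ le_rfl] at hn
    rw [hsd, Nat.card_Icc]
    omega

/-- The number of elements of `S` in the interval `(s, t]`. -/
def countIoc (S : Finset ℕ) (s t : ℕ) : ℕ := (S.filter (fun i => s < i ∧ i ≤ t)).card

theorem countLE_eq_add_countIoc (S : Finset ℕ) {s t : ℕ} (h : s ≤ t) :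
    countLE S t = countLE S s + countIoc S s t := by
  unfold countLE countIoc
  rw [← Finset.card_union_of_disjoint]
  · congr 1
    ext; simp only [Finset.mem_filter, Finset.mem_union]; grind
  · rw [Finset.disjoint_filter]; intros; omega

theorem countIoc_eq_sdiff_add_inter (I J : Finset ℕ) (s t : ℕ) :
    countIoc I s t = countIoc (I \ J) s t + countIoc (I ∩ J) s t := by
  unfold countIoc
  rw [← Finset.card_union_of_disjoint, ← Finset.filter_union, Finset.sdiff_union_inter]
  exact Finset.disjoint_filter_filter (Finset.disjoint_sdiff_inter I J)

theorem countIoc_le_card (S : Finset ℕ) (s t : ℕ) : countIoc S s t ≤ S.card :=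
  Finset.card_filter_le _ _

theorem WShalf_of_card_le_countIoc {I J : Finset ℕ} {s t : ℕ} (hst : s ≤ t)
    (hcard : J.card ≤ I.card)
    (h : (I \ J).card + countIoc J s t ≤ countIoc I s t) : WShalf I J := by
  have e1 := countIoc_eq_sdiff_add_inter I J s t
  have e2 := countIoc_eq_sdiff_add_inter J I s t
  rw [Finset.inter_comm] at e2
  have e3 := countIoc_le_card (I \ J) s t
  have hI : ∀ i ∈ I \ J, s < i ∧ i ≤ t :=
    Finset.card_filter_eq_iff.mp (show countIoc (I \ J) s t = (I \ J).card by omega)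
  have hJ : ∀ j ∈ J \ I, ¬ (s < j ∧ j ≤ t) :=
    Finset.card_filter_eq_zero_iff.mp (show countIoc (J \ I) s t = 0 by omega)
  refine ⟨hcard, (J \ I).filter (· ≤ s), (J \ I).filter (t < ·), ?_, ?_, ?_, ?_⟩
  · rw [Finset.disjoint_filter]; intros; omega
  · rw [← Finset.filter_or, Finset.filter_true_of_mem]
    intro j hj
    have := hJ j hj
    omega
  · intro j hj i hi
    have := (Finset.mem_filter.mp hj).2
    have := hI i hi
    omega
  · intro i hi j hj
    have := (Finset.mem_filter.mp hj).2
    have := hI i hi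
    omega

theorem exists_forall_countLE_sub_le {n : ℕ} {I J : Finset ℕ} (hI : I ⊆ Finset.Icc 1 n)
    (hJ : J ⊆ Finset.Icc 1 n) :
    ∃ s, ∀ t, (countLE J t : ℤ) - countLE I t ≤ (countLE J s : ℤ) - countLE I s := by
  obtain ⟨s, -, hs⟩ := Finset.exists_max_image (Finset.range (n + 1))
    (fun t => (countLE J t : ℤ) - countLE I t) ⟨0, by simp⟩
  refine ⟨s, fun t => ?_⟩
  by_cases ht : t ≤ n
  · exact hs t (by simp only [Finset.mem_range]; omega)
  · have := hs n (by simp)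
    rwa [countLE_of_le hI (by omega : n ≤ t), countLE_of_le hJ (by omega : n ≤ t),
      ← countLE_of_le hI le_rfl, ← countLE_of_le hJ le_rfl]

theorem ExcludesAllBut.exists_ne {K : Type} [Field K] {q : K} {m n : ℕ} (hq : q ≠ 0)
    (hroot : ∀ d : ℤ, q ^ d = 1 → d = 0) {I J : Finset ℕ}
    (hI : I ⊆ Finset.Icc 1 n) (hJ : J ⊆ Finset.Icc 1 n) (hcard : J.card ≤ I.card)
    (hws : ¬ WeaklySeparated I J) :
    ∃ c₁ c₂, ExcludesAllBut q m n I J c₁ ∧ ExcludesAllBut q m n I J c₂ ∧ c₁ ≠ c₂ := by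
  obtain ⟨s, hs⟩ := exists_forall_countLE_sub_le hI hJ
  obtain ⟨t, ht⟩ := exists_forall_countLE_sub_le hJ hI
  obtain ⟨c₁, h₁, hle₁⟩ := exists_ge (m := m) hq hroot I J hI hJ _ hs
  obtain ⟨c₂, h₂, hle₂⟩ := exists_ge (m := m) hq hroot J I hJ hI _ ht
  refine ⟨c₁, -c₂, h₁, h₂.swap hq, fun heq => hws ?_⟩
  have d1 := Finset.card_sdiff_add_card_inter I J
  have d2 := Finset.card_sdiff_add_card_inter J I
  rw [Finset.inter_comm] at d2
  rcases le_total s t with hst | hst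
  · have f1 := countLE_eq_add_countIoc I hst
    have f2 := countLE_eq_add_countIoc J hst
    exact Or.inl (WShalf_of_card_le_countIoc hst hcard (by omega))
  · have f1 := countLE_eq_add_countIoc I hst
    have f2 := countLE_eq_add_countIoc J hst
    have e1 := countIoc_eq_sdiff_add_inter I J t s
    have e2 := countIoc_eq_sdiff_add_inter J I t s
    rw [Finset.inter_comm] at e2
    have e3 := countIoc_le_card (J \ I) t s
    exact Or.inr (WShalf_of_card_le_countIoc hst (by omega) (by omega))

theorem zpow_eq_one_imp_of_transcendental {K : Type} [Field K] [CharZero K] {q : K}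
    (htr : Transcendental ℚ q) (d : ℤ) (hd : q ^ d = 1) : d = 0 := by
  by_contra hne
  have hpow : q ^ d.natAbs = 1 := by
    obtain ⟨k, rfl | rfl⟩ := d.eq_nat_or_neg
    · simpa only [Int.natAbs_natCast, zpow_natCast] using hd
    · simpa only [Int.natAbs_neg, Int.natAbs_natCast, zpow_neg, zpow_natCast, inv_eq_one] using hd
  exact htr (IsAlgebraic.of_pow (Int.natAbs_pos.mpr hne) (hpow ▸ isAlgebraic_one))

/-- Leclerc–Zelevinsky quasicommutation ("only if" direction): if `I, J` are not
weakly separated, some `q`-matrix has non-quasicommuting flag minors `[I]`, `[J]`. -/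
theorem exists_qMatrix_not_quasicommuting
    {n : ℕ} (I J : Finset ℕ) (hIn : I ⊆ Finset.Icc 1 n) (hJn : J ⊆ Finset.Icc 1 n)
    (hws : ¬ WeaklySeparated I J) {m : ℕ} (hm : max I.card J.card ≤ m)
    (K : Type) [Field K] [CharZero K] (q : K) (hq : q ≠ 0)
    (htr : Transcendental ℚ q) :
    ∃ (A : Type) (instA : Ring A),
      letI := instA
      ∃ (instB : Algebra K A),
        letI := instB
        ∃ x : ℕ → ℕ → A, IsQMatrix q m n x ∧
          ∀ c : ℤ, flagMinor q x I * flagMinor q x J ≠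
            (q ^ c) • (flagMinor q x J * flagMinor q x I) := by
  have hroot := zpow_eq_one_imp_of_transcendental htr
  rcases le_total J.card I.card with h | h
  · obtain ⟨c₁, c₂, h₁, h₂, hne⟩ := ExcludesAllBut.exists_ne (m := m) hq hroot hIn hJn h hws
    exact h₁.exists_not_quasicommuting h₂ hne
  · obtain ⟨c₁, c₂, h₁, h₂, hne⟩ :=
      ExcludesAllBut.exists_ne (m := m) hq hroot hJn hIn h (fun h' => hws h'.symm)
    exact (h₁.swap hq).exists_not_quasicommuting (h₂.swap hq) (fun h' => hne (neg_injective h'))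
end

section
/- Let K be a field, q a nonzero element of K, and x an m×n q-matrix with entries in an associative unital K-algebra A. Let 1 ≤ i < j < k ≤ n, let X ⊆ {1,…,n} − {i,j,k}, and suppose m ≥ |X| + 2. Then the flag quantum minors satisfy [Xj]·[Xik] = [Xij]·[Xk] + [Xjk]·[Xi]. -/
/-- The number of elements of `J` smaller than `c`. -/
def belowCard (J : Finset ℕ) (c : ℕ) : ℕ := (J.filter (· < c)).card

/-- The number of elements of `J` larger than `c`. -/
def aboveCard (J : Finset ℕ) (c : ℕ) : ℕ := (J.filter (c < ·)).card

theorem belowCard_insert {J : Finset ℕ} {a : ℕ} (ha : a ∉ J) (c : ℕ) :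
    belowCard (insert a J) c = belowCard J c + if a < c then 1 else 0 := by
  unfold belowCard
  rw [Finset.filter_insert]
  split_ifs with h
  · rw [Finset.card_insert_of_notMem (by simp [ha])]
  · rfl

theorem aboveCard_insert {J : Finset ℕ} {a : ℕ} (ha : a ∉ J) (c : ℕ) :
    aboveCard (insert a J) c = aboveCard J c + if c < a then 1 else 0 := by
  unfold aboveCard
  rw [Finset.filter_insert]
  split_ifs with h
  · rw [Finset.card_insert_of_notMem (by simp [ha])]
  · rfl

theorem belowCard_erase {J : Finset ℕ} {a : ℕ} (ha : a ∈ J) (c : ℕ) :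
    belowCard J c = belowCard (J.erase a) c + if a < c then 1 else 0 := by
  rw [← belowCard_insert (Finset.notMem_erase a J), Finset.insert_erase ha]

theorem aboveCard_erase {J : Finset ℕ} {a : ℕ} (ha : a ∈ J) (c : ℕ) :
    aboveCard J c = aboveCard (J.erase a) c + if c < a then 1 else 0 := by
  rw [← aboveCard_insert (Finset.notMem_erase a J), Finset.insert_erase ha]

theorem belowCard_add_aboveCard {J : Finset ℕ} {c : ℕ} (hc : c ∉ J) :
    belowCard J c + aboveCard J c = J.card := by
  unfold belowCard aboveCard
  rw [← Finset.card_union_of_disjoint]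
  · congr 1
    ext a
    simp only [Finset.mem_union, Finset.mem_filter]
    constructor
    · tauto
    · intro ha
      have : a ≠ c := fun h => hc (h ▸ ha)
      rcases lt_or_gt_of_ne this with h | h <;> tauto
  · rw [Finset.disjoint_filter]
    intro a _ h
    omega

theorem belowCard_add_aboveCard_of_mem {J : Finset ℕ} {c : ℕ} (hc : c ∈ J) :
    belowCard J c + aboveCard J c + 1 = J.card := by
  have h := belowCard_add_aboveCard (Finset.notMem_erase c J)
  have h1 := belowCard_erase hc c
  have h2 := aboveCard_erase hc c
  rw [if_neg (lt_irrefl c)] at h1 h2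
  have := Finset.card_erase_add_one hc
  omega

theorem belowCard_eq_zero {J : Finset ℕ} {c : ℕ} (h : ∀ b ∈ J, c ≤ b) : belowCard J c = 0 := by
  unfold belowCard
  rw [Finset.card_eq_zero, Finset.filter_eq_empty_iff]
  intro b hb
  exact not_lt.2 (h b hb)

section Exterior

variable {K A : Type} [Field K] [Ring A] [Algebra K A]

/-- Left multiplication by `∑ v c e_c` on the exterior algebra with `e_b e_a = t e_a e_b` for
`a < b`, an element `∑ f J e_J` being encoded by its coefficients `f`. -/
def extMul (t : K) (v : ℕ → A) (f : Finset ℕ → A) (J : Finset ℕ) : A :=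
  ∑ c ∈ J, t ^ belowCard J c • (v c * f (J.erase c))

/-- Right multiplication by `∑ v c e_c` on the exterior algebra of `extMul`. -/
def extMulRight (t : K) (v : ℕ → A) (f : Finset ℕ → A) (J : Finset ℕ) : A :=
  ∑ c ∈ J, t ^ aboveCard J c • (f (J.erase c) * v c)

theorem extMul_smul (t s : K) (v : ℕ → A) (f : Finset ℕ → A) :
    extMul t v (s • f) = s • extMul t v f := by
  ext J
  simp only [extMul, Pi.smul_apply, Finset.smul_sum]
  refine Finset.sum_congr rfl fun c _ => ?_
  rw [mul_smul_comm, smul_comm]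

theorem extMul_zero (t : K) (v : ℕ → A) : extMul t v (0 : Finset ℕ → A) = 0 := by
  ext J
  simp [extMul]

theorem extMul_extMul_apply (t : K) (u v : ℕ → A) (f : Finset ℕ → A) (J : Finset ℕ) :
    extMul t u (extMul t v f) J = ∑ a ∈ J, ∑ b ∈ J with a < b,
      t ^ (belowCard J a + belowCard (J.erase a) b) •
        ((u a * v b + t • (u b * v a)) * f ((J.erase a).erase b)) := by
  have h1 : extMul t u (extMul t v f) J = ∑ a ∈ J, (∑ b ∈ J with a < b,
      t ^ (belowCard J a + belowCard (J.erase a) b) • (u a * v b * f ((J.erase a).erase b)) +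
      ∑ b ∈ J with b < a,
      t ^ (belowCard J a + belowCard (J.erase a) b) •
        (u a * v b * f ((J.erase a).erase b))) := by
    unfold extMul
    refine Finset.sum_congr rfl fun a _ => ?_
    rw [← Finset.sum_union, Finset.mul_sum, Finset.smul_sum]
    · refine Finset.sum_congr ?_ fun b _ => ?_
      · ext b
        simp only [Finset.mem_erase, Finset.mem_union, Finset.mem_filter]
        rw [← and_or_left, and_comm, ne_comm, ne_iff_lt_or_gt]
      · rw [mul_smul_comm, smul_smul, ← pow_add, mul_assoc]
    · rw [Finset.disjoint_filter]
      intro b _ h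
      omega
  have h2 : ∑ a ∈ J, ∑ b ∈ J with b < a,
      t ^ (belowCard J a + belowCard (J.erase a) b) • (u a * v b * f ((J.erase a).erase b)) =
      ∑ a ∈ J, ∑ b ∈ J with a < b,
      t ^ (belowCard J b + belowCard (J.erase b) a) •
        (u b * v a * f ((J.erase b).erase a)) := by
    simp only [Finset.sum_filter]
    rw [Finset.sum_comm]
  rw [h1, Finset.sum_add_distrib, h2, ← Finset.sum_add_distrib]
  refine Finset.sum_congr rfl fun a ha => ?_
  rw [← Finset.sum_add_distrib]
  refine Finset.sum_congr rfl fun b hb => ?_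
  obtain ⟨hb, hab⟩ := Finset.mem_filter.1 hb
  have e1 := belowCard_erase ha b
  have e2 := belowCard_erase hb a
  rw [if_pos hab] at e1
  rw [if_neg hab.asymm] at e2
  rw [Finset.erase_right_comm, show belowCard J b + belowCard (J.erase b) a =
    belowCard J a + belowCard (J.erase a) b + 1 by omega, pow_succ, mul_smul, ← smul_add,
    add_mul, smul_mul_assoc]

theorem extMul_extMul_eq_smul {t s : K} {u v u' v' : ℕ → A}
    (h : ∀ a b, a < b → u a * v b + t • (u b * v a) = s • (u' a * v' b + t • (u' b * v' a)))
    (f : Finset ℕ → A) :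
    extMul t u (extMul t v f) = s • extMul t u' (extMul t v' f) := by
  ext J
  rw [Pi.smul_apply, extMul_extMul_apply, extMul_extMul_apply, Finset.smul_sum]
  refine Finset.sum_congr rfl fun a _ => ?_
  rw [Finset.smul_sum]
  refine Finset.sum_congr rfl fun b hb => ?_
  rw [h a b (Finset.mem_filter.1 hb).2, smul_mul_assoc, smul_comm]

theorem extMul_extMulRight_comm (t : K) (u v : ℕ → A) (f : Finset ℕ → A) :
    extMul t u (extMulRight t v f) = extMulRight t v (extMul t u f) := by
  ext J
  unfold extMul extMulRight
  have h1 : ∀ a ∈ J, t ^ belowCard J a • (u a * ∑ b ∈ J.erase a,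
      t ^ aboveCard (J.erase a) b • (f ((J.erase a).erase b) * v b)) = ∑ b ∈ J, if a = b then 0 else
      t ^ (belowCard J a + aboveCard (J.erase a) b) • (u a * f ((J.erase a).erase b) * v b) := by
    intro a ha
    rw [← Finset.add_sum_erase _ _ ha, if_pos rfl, zero_add, Finset.mul_sum, Finset.smul_sum]
    refine Finset.sum_congr rfl fun b hb => ?_
    rw [if_neg (Finset.ne_of_mem_erase hb).symm, mul_smul_comm, smul_smul, ← pow_add, mul_assoc]
  have h2 : ∀ b ∈ J, t ^ aboveCard J b • ((∑ a ∈ J.erase b,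
      t ^ belowCard (J.erase b) a • (u a * f ((J.erase b).erase a))) * v b) =
      ∑ a ∈ J, if a = b then 0 else
      t ^ (aboveCard J b + belowCard (J.erase b) a) • (u a * f ((J.erase b).erase a) * v b) := by
    intro b hb
    rw [← Finset.add_sum_erase _ _ hb, if_pos rfl, zero_add, Finset.sum_mul, Finset.smul_sum]
    refine Finset.sum_congr rfl fun a ha => ?_
    rw [if_neg (Finset.ne_of_mem_erase ha), smul_mul_assoc, smul_smul, ← pow_add]
  rw [Finset.sum_congr rfl h1, Finset.sum_congr rfl h2, Finset.sum_comm]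
  refine Finset.sum_congr rfl fun b hb => Finset.sum_congr rfl fun a ha => ?_
  split_ifs with hab
  · rfl
  have e1 := aboveCard_erase ha b
  have e2 := belowCard_erase hb a
  rw [Finset.erase_right_comm, show aboveCard J b + belowCard (J.erase b) a =
    belowCard J a + aboveCard (J.erase a) b by omega]

/-- The minors with the list of rows `l`, as functions of the set of columns. -/
noncomputable def rowMinor (t : K) (x : ℕ → ℕ → A) : List ℕ → Finset ℕ → A
  | [] => fun J => if J = ∅ then 1 else 0
  | r :: l => extMul t (x r) (rowMinor t x l)

/-- The minors with the set of rows `I`, as functions of the set of columns. -/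
noncomputable def extMinor (t : K) (x : ℕ → ℕ → A) (I : Finset ℕ) : Finset ℕ → A :=
  rowMinor t x I.sort

theorem extMinor_empty (t : K) (x : ℕ → ℕ → A) (J : Finset ℕ) :
    extMinor t x ∅ J = if J = ∅ then 1 else 0 := by
  simp [extMinor, rowMinor]

theorem extMinor_insert (t : K) (x : ℕ → ℕ → A) {a : ℕ} {I : Finset ℕ} (h : ∀ b ∈ I, a < b) :
    extMinor t x (insert a I) = extMul t (x a) (extMinor t x I) := by
  rw [extMinor, Finset.sort_insert _ (fun b hb => (h b hb).le) fun ha => (h a ha).false]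
  rfl

/-- Manin's relations for a matrix with rows and columns indexed by all natural numbers. -/
structure IsFullQMatrix (q : K) (x : ℕ → ℕ → A) : Prop where
  row : ∀ i j k, j < k → x i j * x i k = q • (x i k * x i j)
  col : ∀ i l j, i < l → x i j * x l j = q • (x l j * x i j)
  comm : ∀ i l j k, i < l → j < k → x i k * x l j = x l j * x i k
  cross : ∀ i l j k, i < l → j < k →
    x i j * x l k - x l k * x i j = (q - q⁻¹) • (x i k * x l j)

namespace IsFullQMatrix

variable {q : K} {x : ℕ → ℕ → A}

theorem transpose (hx : IsFullQMatrix q x) : IsFullQMatrix q fun i j => x j i where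
  row i j k h := hx.col j k i h
  col i l j h := hx.row j i l h
  comm i l j k h h' := (hx.comm j k i l h' h).symm
  cross i l j k h h' := by
    rw [← hx.comm j k i l h' h]
    exact hx.cross j k i l h' h

theorem extMul_self (hx : IsFullQMatrix q x) (r : ℕ) (f : Finset ℕ → A) :
    extMul (-q) (x r) (extMul (-q) (x r) f) = 0 := by
  rw [extMul_extMul_eq_smul (s := (0 : K)) (u' := x r) (v' := x r), zero_smul]
  intro a b hab
  rw [hx.row r a b hab, neg_smul, zero_smul, add_neg_cancel]

theorem extMul_swap (hx : IsFullQMatrix q x) (hq : q ≠ 0) {r s : ℕ} (h : r < s)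
    (f : Finset ℕ → A) :
    extMul (-q) (x s) (extMul (-q) (x r) f) = (-q) • extMul (-q) (x r) (extMul (-q) (x s) f) := by
  apply extMul_extMul_eq_smul
  intro a b hab
  have h1 := hx.cross r s a b h hab
  have h2 := hx.comm r s a b h hab
  rw [sub_eq_iff_eq_add] at h1
  rw [h1, ← h2]
  match_scalars <;> field_simp
  ring

/-- Left multiplication of the minors with rows `R` by the row `r`. -/
theorem extMul_extMinor (hx : IsFullQMatrix q x) (hq : q ≠ 0) (r : ℕ) (R : Finset ℕ) :
    extMul (-q) (x r) (extMinor (-q) x R) =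
      if r ∈ R then 0 else (-q) ^ belowCard R r • extMinor (-q) x (insert r R) := by
  induction R using Finset.induction_on_min with
  | empty =>
    rw [if_neg (Finset.notMem_empty r), belowCard_eq_zero (by simp), pow_zero, one_smul,
      extMinor_insert _ _ (by simp)]
  | insert a S ha ih =>
    have haS : a ∉ S := fun h => (ha a h).false
    rcases lt_trichotomy r a with h | rfl | h
    · have hr : ∀ b ∈ insert a S, r < b := by
        intro b hb
        rcases Finset.mem_insert.1 hb with rfl | hb
        · exact h
        · exact h.trans (ha b hb)
      rw [if_neg fun h' => (hr r h').false, belowCard_eq_zero fun b hb => (hr b hb).le, pow_zero,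
        one_smul, extMinor_insert _ _ hr]
    · rw [if_pos (Finset.mem_insert_self _ _), extMinor_insert _ _ ha, hx.extMul_self]
    · rw [extMinor_insert _ _ ha, hx.extMul_swap hq h, ih, belowCard_insert haS, if_pos h]
      by_cases hr : r ∈ S
      · rw [if_pos hr, if_pos (Finset.mem_insert_of_mem hr), extMul_zero, smul_zero]
      · rw [if_neg hr, if_neg (by simp [hr, h.ne']), extMul_smul, Finset.insert_comm,
          extMinor_insert (a := a), smul_smul, pow_succ']
        intro b hb
        rcases Finset.mem_insert.1 hb with rfl | hb
        · exact h
        · exact ha b hb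

/-- Right multiplication of the minors with rows `R` by the row `r`. -/
theorem extMulRight_extMinor (hx : IsFullQMatrix q x) (hq : q ≠ 0) (r : ℕ) (R : Finset ℕ) :
    extMulRight (-q) (x r) (extMinor (-q) x R) =
      if r ∈ R then 0 else (-q) ^ aboveCard R r • extMinor (-q) x (insert r R) := by
  induction R using Finset.induction_on_min with
  | empty =>
    rw [if_neg (Finset.notMem_empty r), extMinor_insert _ _ (by simp)]
    ext J
    simp only [extMulRight, extMul, Pi.smul_apply, Finset.smul_sum, extMinor_empty, aboveCard,
      Finset.filter_empty, Finset.card_empty, pow_zero, one_smul]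
    refine Finset.sum_congr rfl fun c hc => ?_
    split_ifs with h
    · have h1 := belowCard_erase hc c
      have h2 := aboveCard_erase hc c
      simp only [h, lt_irrefl, if_false] at h1 h2
      rw [show (J.filter (c < ·)).card = aboveCard J c from rfl, h1, h2]
      simp [belowCard, aboveCard]
    · simp
  | insert a S ha ih =>
    have haS : a ∉ S := fun h => (ha a h).false
    rw [extMinor_insert _ _ ha, ← extMul_extMulRight_comm, ih]
    rcases lt_trichotomy r a with h | rfl | h
    · have hr : ∀ b ∈ S, r < b := fun b hb => h.trans (ha b hb)
      have hr' : ∀ b ∈ insert a S, r < b := by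
        intro b hb
        rcases Finset.mem_insert.1 hb with rfl | hb
        · exact h
        · exact hr b hb
      rw [if_neg fun h' => (hr r h').false, if_neg fun h' => (hr' r h').false,
        aboveCard_insert haS, if_pos h, extMul_smul, extMinor_insert _ _ hr,
        hx.extMul_swap hq h, extMinor_insert _ _ hr', extMinor_insert _ _ ha, smul_smul, pow_succ]
    · rw [if_neg haS, if_pos (Finset.mem_insert_self _ _), extMul_smul, extMinor_insert _ _ ha,
        hx.extMul_self, smul_zero]
    · rw [aboveCard_insert haS, if_neg h.asymm, add_zero]
      by_cases hr : r ∈ S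
      · rw [if_pos hr, if_pos (Finset.mem_insert_of_mem hr), extMul_zero]
      · rw [if_neg hr, if_neg (by simp [hr, h.ne']), extMul_smul, Finset.insert_comm r a,
          extMinor_insert (a := a)]
        intro b hb
        rcases Finset.mem_insert.1 hb with rfl | hb
        · exact h
        · exact ha b hb

/-- Expanding minors along rows or along columns gives the same result. -/
theorem extMinor_transpose (hx : IsFullQMatrix q x) (t : K) (I J : Finset ℕ) :
    extMinor t x I J = extMinor t (fun i j => x j i) J I := by
  obtain ⟨n, hn⟩ : ∃ n, I.card ≤ n := ⟨_, le_rfl⟩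
  induction n generalizing I J with
  | zero =>
    obtain rfl := Finset.card_eq_zero.1 (Nat.le_zero.1 hn)
    rw [extMinor_empty]
    induction J using Finset.induction_on_min with
    | empty => simp [extMinor_empty]
    | insert c J hc _ => simp [extMinor_insert _ _ hc, extMul]
  | succ n ih =>
    induction I using Finset.induction_on_min with
    | empty => exact ih _ _ (by simp)
    | insert r R hr _ =>
    have hrR : r ∉ R := fun h => (hr r h).false
    rw [Finset.card_insert_of_notMem hrR, Nat.add_le_add_iff_right] at hn
    induction J using Finset.induction_on_min with
    | empty => simp [extMinor_insert _ _ hr, extMinor_empty, extMul]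
    | insert c J hc _ =>
    have hcJ : c ∉ J := fun h => (hc c h).false
    rw [extMinor_insert _ _ hr, extMinor_insert _ _ hc, extMul, extMul, Finset.sum_insert hcJ,
      Finset.sum_insert hrR, Finset.erase_insert hcJ, Finset.erase_insert hrR, ih R J hn]
    congr 1
    · congr 2
      rw [belowCard_insert hcJ, belowCard_insert hrR, belowCard_eq_zero fun b hb => (hc b hb).le,
        belowCard_eq_zero fun b hb => (hr b hb).le]
      simp
    have h1 : ∀ d ∈ J, t ^ belowCard (insert c J) d •
        (x r d * extMinor t x R ((insert c J).erase d)) = ∑ s ∈ R,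
        t ^ (belowCard J d + belowCard R s + 1) •
          (x r d * x s c * extMinor t (fun i j => x j i) (J.erase d) (R.erase s)) := by
      intro d hd
      rw [Finset.erase_insert_of_ne (hc d hd).ne, ih _ _ hn,
        extMinor_insert _ _ fun b hb => hc b (Finset.mem_of_mem_erase hb), extMul,
        belowCard_insert hcJ, if_pos (hc d hd), Finset.mul_sum, Finset.smul_sum]
      refine Finset.sum_congr rfl fun s _ => ?_
      rw [mul_smul_comm, smul_smul, ← pow_add, mul_assoc, add_right_comm]
    have h2 : ∀ s ∈ R, t ^ belowCard (insert r R) s •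
        (x s c * extMinor t (fun i j => x j i) J ((insert r R).erase s)) = ∑ d ∈ J,
        t ^ (belowCard J d + belowCard R s + 1) •
          (x s c * x r d * extMinor t (fun i j => x j i) (J.erase d) (R.erase s)) := by
      intro s hs
      have hR : (R.erase s).card + 1 ≤ n := by rwa [Finset.card_erase_add_one hs]
      have hrs : r ∉ R.erase s := fun h => hrR (Finset.mem_of_mem_erase h)
      rw [Finset.erase_insert_of_ne (hr s hs).ne,
        ← ih _ _ (by rwa [Finset.card_insert_of_notMem hrs]),
        extMinor_insert _ _ fun b hb => hr b (Finset.mem_of_mem_erase hb), extMul,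
        belowCard_insert hrR, if_pos (hr s hs), Finset.mul_sum, Finset.smul_sum]
      refine Finset.sum_congr rfl fun d _ => ?_
      rw [ih _ _ (Nat.le_of_succ_le hR), mul_smul_comm, smul_smul, ← pow_add, mul_assoc,
        add_comm (belowCard J d), add_right_comm]
    rw [Finset.sum_congr rfl h1, Finset.sum_congr rfl h2, Finset.sum_comm]
    refine Finset.sum_congr rfl fun s hs => Finset.sum_congr rfl fun d hd => ?_
    rw [hx.comm r s c d (hr s hs) (hc d hd)]

theorem row_expansion (hx : IsFullQMatrix q x) (hq : q ≠ 0) (r : ℕ) (R J : Finset ℕ) :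
    ∑ c ∈ J, (-q) ^ belowCard J c • (x r c * extMinor (-q) x R (J.erase c)) =
      if r ∈ R then 0 else (-q) ^ belowCard R r • extMinor (-q) x (insert r R) J := by
  have h := congrFun (hx.extMul_extMinor hq r R) J
  rw [extMul] at h
  rw [h]
  split_ifs <;> rfl

theorem column_expansion (hx : IsFullQMatrix q x) (hq : q ≠ 0) (c : ℕ) (R J : Finset ℕ) :
    ∑ r ∈ R, (-q) ^ aboveCard R r • (extMinor (-q) x (R.erase r) J * x r c) =
      if c ∈ J then 0 else (-q) ^ aboveCard J c • extMinor (-q) x R (insert c J) := by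
  have h := congrFun (hx.transpose.extMulRight_extMinor hq c J) R
  rw [extMulRight] at h
  simp only [hx.extMinor_transpose]
  rw [h]
  split_ifs <;> rfl

theorem extMinor_mul_entry (hx : IsFullQMatrix q x) (hq : q ≠ 0) {r : ℕ} {R : Finset ℕ}
    (hr : r ∈ R) (J : Finset ℕ) (e : ℕ) :
    (-q) ^ (R.card - 1) • (extMinor (-q) x R J * x r e) =
      ∑ a ∈ J, (-q) ^ belowCard J a • (x r a * if e ∈ J.erase a then 0 else
        (-q) ^ aboveCard (J.erase a) e • extMinor (-q) x R (insert e (J.erase a))) := by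
  have h1 : ∀ s ∈ R, ∑ a ∈ J, (-q) ^ belowCard J a • (x r a *
      (-q) ^ aboveCard R s • (extMinor (-q) x (R.erase s) (J.erase a) * x s e)) =
      if r = s then (-q) ^ (R.card - 1) • (extMinor (-q) x R J * x r e) else 0 := by
    intro s _
    have h := congrArg (fun y => (-q) ^ aboveCard R s • (y * x s e))
      (hx.row_expansion hq r (R.erase s) J)
    simp only [Finset.sum_mul, Finset.smul_sum] at h
    refine (Finset.sum_congr rfl fun a _ => ?_).trans (h.trans ?_)
    · rw [mul_smul_comm, smul_mul_assoc, smul_comm, mul_assoc]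
    · by_cases hrs : r = s
      · subst hrs
        have h2 := belowCard_add_aboveCard_of_mem hr
        have h3 := belowCard_erase hr r
        rw [if_neg (lt_irrefl r)] at h3
        rw [if_neg (Finset.notMem_erase r R), if_pos rfl, Finset.insert_erase hr, smul_mul_assoc,
          smul_smul, ← pow_add]
        congr 2
        omega
      · rw [if_pos (Finset.mem_erase.2 ⟨hrs, hr⟩), if_neg hrs, zero_mul, smul_zero]
  have h2 := Finset.sum_congr rfl h1
  rw [Finset.sum_ite_eq R r, if_pos hr, Finset.sum_comm] at h2
  rw [← h2]
  refine Finset.sum_congr rfl fun a _ => ?_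
  rw [← hx.column_expansion hq e R (J.erase a), Finset.mul_sum, Finset.smul_sum]

/-- A maximal minor commutes with the entries of its submatrix. -/
theorem commute_entry (hx : IsFullQMatrix q x) (hq : q ≠ 0) {r e : ℕ} {R J : Finset ℕ}
    (hr : r ∈ R) (he : e ∈ J) (hRJ : R.card = J.card) :
    Commute (extMinor (-q) x R J) (x r e) := by
  have h := hx.extMinor_mul_entry hq hr J e
  rw [Finset.sum_eq_single_of_mem e he, if_neg (Finset.notMem_erase e J), Finset.insert_erase he,
    mul_smul_comm, smul_smul, ← pow_add] at h
  · have h2 := belowCard_add_aboveCard_of_mem he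
    have h3 := aboveCard_erase he e
    rw [if_neg (lt_irrefl e)] at h3
    rw [show belowCard J e + aboveCard (J.erase e) e = R.card - 1 by omega] at h
    exact smul_right_injective A (pow_ne_zero _ (neg_ne_zero.2 hq)) h
  · intro a _ hae
    rw [if_pos (Finset.mem_erase.2 ⟨hae.symm, he⟩), mul_zero, smul_zero]

/-- A maximal minor commutes with the minors of its submatrix. -/
theorem commute_extMinor (hx : IsFullQMatrix q x) (hq : q ≠ 0) {R J : Finset ℕ}
    (hRJ : R.card = J.card) {I X : Finset ℕ} (hI : I ⊆ R) (hX : X ⊆ J) :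
    Commute (extMinor (-q) x R J) (extMinor (-q) x I X) := by
  induction I using Finset.induction_on_min generalizing X with
  | empty =>
    rw [extMinor_empty]
    split_ifs
    · exact Commute.one_right _
    · exact Commute.zero_right _
  | insert r I hr ih =>
    rw [extMinor_insert _ _ hr, extMul]
    refine Commute.sum_right _ _ _ fun c hc => Commute.smul_right (Commute.mul_right ?_ ?_) _
    · exact hx.commute_entry hq (hI (Finset.mem_insert_self _ _)) (hX hc) hRJ
    · exact ih ((Finset.subset_insert _ _).trans hI) ((Finset.erase_subset _ _).trans hX)

theorem extMinor_mul_entry_add (hx : IsFullQMatrix q x) (hq : q ≠ 0) {r : ℕ} {R : Finset ℕ}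
    (hr : r ∈ R) {J : Finset ℕ} {e : ℕ} (he : e ∉ J) (s : K) :
    (-q) ^ (R.card - 1) • (extMinor (-q) x R J * x r e) +
        (s * (-q) ^ belowCard J e) • (x r e * extMinor (-q) x R J) =
      ∑ a ∈ J, ((-q) ^ belowCard J a *
        ((-q) ^ aboveCard (J.erase a) e - s * (-q) ^ if e < a then 1 else 0)) •
        (x r a * extMinor (-q) x R (insert e (J.erase a))) := by
  have h := congrArg (s • ·) (hx.row_expansion hq r R (insert e J))
  simp only [if_pos hr, smul_zero, Finset.sum_insert he, Finset.erase_insert he, smul_add,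
    smul_smul, belowCard_insert he, if_neg (lt_irrefl e), add_zero, Finset.smul_sum] at h
  rw [eq_neg_of_add_eq_zero_left h, hx.extMinor_mul_entry hq hr, ← sub_eq_add_neg,
    ← Finset.sum_sub_distrib]
  refine Finset.sum_congr rfl fun a ha => ?_
  have hea : e ≠ a := fun h => he (h ▸ ha)
  rw [if_neg fun h => he (Finset.mem_of_mem_erase h), Finset.erase_insert_of_ne hea, mul_smul_comm,
    smul_smul, ← sub_smul]
  congr 1
  rw [pow_add]
  ring

theorem extMinor_mul_extMinor_insert (hx : IsFullQMatrix q x) (hq : q ≠ 0) {I R : Finset ℕ}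
    (hI : I ⊆ R) {X J : Finset ℕ} (hX : X ⊆ J) (hRJ : R.card = J.card) {e : ℕ} (he : e ∉ J)
    {s : K} (hs : ∀ a ∈ J, a ∉ X →
      (-q) ^ aboveCard (J.erase a) e = s * (-q) ^ if e < a then 1 else 0) :
    (-q) ^ (R.card - 1) • (extMinor (-q) x R J * extMinor (-q) x I (insert e X)) =
      -((s * (-q) ^ belowCard J e) • (extMinor (-q) x I (insert e X) * extMinor (-q) x R J)) := by
  have ht := neg_ne_zero.2 hq
  have hF := hx.column_expansion hq e I X
  rw [if_neg fun h => he (hX h)] at hF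
  apply smul_right_injective A (pow_ne_zero (aboveCard X e) ht)
  simp only
  rw [← sub_eq_zero, smul_neg, sub_neg_eq_add, smul_comm _ ((-q) ^ (R.card - 1)),
    smul_comm _ (s * (-q) ^ belowCard J e), ← mul_smul_comm ((-q) ^ aboveCard X e),
    ← smul_mul_assoc ((-q) ^ aboveCard X e), ← hF, Finset.mul_sum, Finset.sum_mul,
    Finset.smul_sum, Finset.smul_sum, ← Finset.sum_add_distrib]
  have h1 : ∀ r ∈ I, (-q) ^ (R.card - 1) • (extMinor (-q) x R J *
        (-q) ^ aboveCard I r • (extMinor (-q) x (I.erase r) X * x r e)) +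
      (s * (-q) ^ belowCard J e) • ((-q) ^ aboveCard I r •
        (extMinor (-q) x (I.erase r) X * x r e) * extMinor (-q) x R J) =
      ∑ a ∈ J, ((-q) ^ belowCard J a *
        ((-q) ^ aboveCard (J.erase a) e - s * (-q) ^ if e < a then 1 else 0)) •
        ((-q) ^ aboveCard I r • (extMinor (-q) x (I.erase r) X * x r a) *
          extMinor (-q) x R (insert e (J.erase a))) := by
    intro r hr
    have h := congrArg (fun y => (-q) ^ aboveCard I r • (extMinor (-q) x (I.erase r) X * y))
      (hx.extMinor_mul_entry_add hq (hI hr) he s)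
    simp only [Finset.mul_sum, Finset.smul_sum, mul_add, smul_add] at h
    refine Eq.trans ?_ (h.trans (Finset.sum_congr rfl fun a _ => ?_))
    · have hc := hx.commute_extMinor hq hRJ ((Finset.erase_subset r I).trans hI) hX
      congr 1
      · rw [mul_smul_comm, mul_smul_comm, smul_comm, ← mul_assoc, hc.eq, mul_assoc]
      · rw [mul_smul_comm, smul_mul_assoc, smul_comm, mul_assoc]
    · rw [mul_smul_comm, smul_comm, smul_mul_assoc, mul_assoc]
  rw [Finset.sum_congr rfl h1, Finset.sum_comm]
  refine Finset.sum_eq_zero fun a ha => ?_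
  rw [← Finset.smul_sum, ← Finset.sum_mul, hx.column_expansion hq a I X]
  by_cases haX : a ∈ X
  · rw [if_pos haX, zero_mul, smul_zero]
  · rw [hs a ha haX, sub_self, mul_zero, zero_smul]

theorem extMinor_mul_extMinor_insert_of_lt (hx : IsFullQMatrix q x) (hq : q ≠ 0) {I R : Finset ℕ}
    (hI : I ⊆ R) {X J : Finset ℕ} (hX : X ⊆ J) (hRJ : R.card = J.card) (hJ : J.Nonempty) {e : ℕ}
    (he : e ∉ J) (h : ∀ a ∈ J, a ∉ X → a < e) :
    extMinor (-q) x R J * extMinor (-q) x I (insert e X) =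
      q • (extMinor (-q) x I (insert e X) * extMinor (-q) x R J) := by
  have ht := neg_ne_zero.2 hq
  apply smul_right_injective A (pow_ne_zero (R.card - 1) ht)
  simp only
  rw [hx.extMinor_mul_extMinor_insert hq hI hX hRJ he (s := (-q) ^ aboveCard J e), ← pow_add,
    add_comm, belowCard_add_aboveCard he, ← hRJ, ← neg_smul, smul_smul]
  · congr 1
    obtain ⟨n, hn⟩ := Nat.exists_eq_succ_of_ne_zero (hRJ ▸ hJ.card_pos.ne')
    rw [hn, Nat.succ_sub_one, pow_succ]
    ring
  · intro a ha haX
    rw [aboveCard_erase ha e, if_neg (h a ha haX).asymm]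
    simp

theorem extMinor_mul_extMinor_insert_of_gt (hx : IsFullQMatrix q x) (hq : q ≠ 0) {I R : Finset ℕ}
    (hI : I ⊆ R) {X J : Finset ℕ} (hX : X ⊆ J) (hRJ : R.card = J.card) (hJ : J.Nonempty) {e : ℕ}
    (he : e ∉ J) (h : ∀ a ∈ J, a ∉ X → e < a) :
    extMinor (-q) x R J * extMinor (-q) x I (insert e X) =
      q⁻¹ • (extMinor (-q) x I (insert e X) * extMinor (-q) x R J) := by
  have ht := neg_ne_zero.2 hq
  apply smul_right_injective A (pow_ne_zero (R.card - 1) ht)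
  simp only
  rw [hx.extMinor_mul_extMinor_insert hq hI hX hRJ he
    (s := (-q) ^ aboveCard J e * ((-q) ^ 2)⁻¹), mul_right_comm, ← pow_add,
    add_comm, belowCard_add_aboveCard he, ← hRJ, ← neg_smul, smul_smul]
  · congr 1
    obtain ⟨n, hn⟩ := Nat.exists_eq_succ_of_ne_zero (hRJ ▸ hJ.card_pos.ne')
    rw [hn, Nat.succ_sub_one, pow_succ]
    field_simp
  · intro a ha haX
    rw [aboveCard_erase ha e, if_pos (h a ha haX), pow_succ, pow_one]
    field_simp

/-- The quantum Plücker relation with one factor containing all but one of the columns in `Z`. -/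
theorem sum_extMinor_mul_extMinor (hx : IsFullQMatrix q x) (hq : q ≠ 0) {I R : Finset ℕ}
    (hI : I ⊆ R) (X Z : Finset ℕ) :
    ∑ c ∈ Z, (-q) ^ belowCard Z c • ((if c ∈ X then 0 else
      (-q) ^ aboveCard X c • extMinor (-q) x I (insert c X)) *
        extMinor (-q) x R (Z.erase c)) = 0 := by
  have h1 : ∀ c ∈ Z, (-q) ^ belowCard Z c • ((if c ∈ X then 0 else
      (-q) ^ aboveCard X c • extMinor (-q) x I (insert c X)) * extMinor (-q) x R (Z.erase c)) =
      ∑ r ∈ I, ((-q) ^ aboveCard I r • extMinor (-q) x (I.erase r) X) *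
        (-q) ^ belowCard Z c • (x r c * extMinor (-q) x R (Z.erase c)) := by
    intro c _
    rw [← hx.column_expansion hq c I X, Finset.sum_mul, Finset.smul_sum]
    refine Finset.sum_congr rfl fun r _ => ?_
    simp only [smul_mul_assoc, mul_smul_comm, mul_assoc]
  rw [Finset.sum_congr rfl h1, Finset.sum_comm]
  refine Finset.sum_eq_zero fun r hr => ?_
  rw [← Finset.mul_sum, hx.row_expansion hq, if_pos (hI hr), mul_zero]

theorem extMinor_triple_identity (hx : IsFullQMatrix q x) (hq : q ≠ 0) {I R : Finset ℕ}
    (hI : I ⊆ R) {X : Finset ℕ} (hR : R.card = X.card + 2) {i j k : ℕ} (hij : i < j) (hjk : j < k)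
    (hiX : i ∉ X) (hjX : j ∉ X) (hkX : k ∉ X) :
    extMinor (-q) x I (insert j X) * extMinor (-q) x R (insert i (insert k X)) =
      extMinor (-q) x R (insert i (insert j X)) * extMinor (-q) x I (insert k X) +
        extMinor (-q) x R (insert j (insert k X)) * extMinor (-q) x I (insert i X) := by
  have ht := neg_ne_zero.2 hq
  have hik := hij.trans hjk
  have hj : j ∉ insert k X := by simp [hjX, hjk.ne]
  have hi : i ∉ insert j (insert k X) := by simp [hiX, hij.ne, hik.ne]
  rw [hx.extMinor_mul_extMinor_insert_of_lt hq hI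
      (fun a ha => by simp [ha]) (by simp [*, hij.ne]) (by simp)
      (by simp [*, hik.ne', hjk.ne']) (by intro a ha haX; simp [haX] at ha; omega),
    hx.extMinor_mul_extMinor_insert_of_gt hq hI
      (fun a ha => by simp [ha]) (by simp [*]) (by simp)
      hi (by intro a ha haX; simp [haX] at ha; omega)]
  have h := hx.sum_extMinor_mul_extMinor hq hI X (insert i (insert j (insert k X)))
  rw [Finset.sum_insert hi, Finset.sum_insert hj, Finset.sum_insert hkX,
    Finset.sum_eq_zero fun c hc => by rw [if_pos hc, zero_mul, smul_zero]] at h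
  rw [if_neg hiX, if_neg hjX, if_neg hkX, Finset.erase_insert hi,
    Finset.erase_insert_of_ne hij.ne, Finset.erase_insert hj,
    Finset.erase_insert_of_ne hik.ne, Finset.erase_insert_of_ne hjk.ne,
    Finset.erase_insert hkX] at h
  simp only [belowCard_insert hi, belowCard_insert hj, belowCard_insert hkX, if_pos hij, if_pos hik,
    if_pos hjk, lt_irrefl, hij.asymm, hik.asymm, hjk.asymm, if_false, add_zero, smul_mul_assoc,
    smul_smul, ← pow_add] at h
  have ei := belowCard_add_aboveCard hiX
  have ej := belowCard_add_aboveCard hjX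
  have ek := belowCard_add_aboveCard hkX
  rw [ei, show belowCard X j + 1 + aboveCard X j = X.card + 1 by omega,
    show belowCard X k + 1 + 1 + aboveCard X k = X.card + 2 by omega] at h
  apply smul_right_injective A (pow_ne_zero (X.card + 1) ht)
  simp only
  rw [eq_comm, ← sub_eq_zero, ← neg_eq_zero, ← h]
  match_scalars <;> field_simp
  all_goals ring

end IsFullQMatrix

end Exterior

theorem belowCard_orderEmbOfFin {J : Finset ℕ} {k : ℕ} (h : J.card = k) (p : Fin k) :
    belowCard J (J.orderEmbOfFin h p) = p := by
  rw [← Fin.card_Iio, ← Finset.card_map (J.orderEmbOfFin h).toEmbedding, belowCard]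
  congr 1
  ext a
  simp only [Finset.mem_filter, Finset.mem_map, Finset.mem_Iio]
  constructor
  · rintro ⟨ha, hlt⟩
    obtain ⟨b, rfl⟩ : a ∈ Set.range (J.orderEmbOfFin h) := by
      rwa [Finset.range_orderEmbOfFin]
    exact ⟨b, (J.orderEmbOfFin h).lt_iff_lt.1 hlt, rfl⟩
  · rintro ⟨b, hb, rfl⟩
    exact ⟨Finset.orderEmbOfFin_mem _ _ _, (J.orderEmbOfFin h).lt_iff_lt.2 hb⟩

/-- The permutation of `Fin (k + 1)` sending `0` to `p` and ordered like `τ` elsewhere. -/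
def consPerm {k : ℕ} (p : Fin (k + 1)) (τ : Equiv.Perm (Fin k)) : Equiv.Perm (Fin (k + 1)) :=
  (Equiv.Perm.decomposeFin.symm (0, τ)).trans p.cycleRange.symm

theorem consPerm_zero {k : ℕ} (p : Fin (k + 1)) (τ : Equiv.Perm (Fin k)) :
    consPerm p τ 0 = p := by
  simp [consPerm]

theorem consPerm_succ {k : ℕ} (p : Fin (k + 1)) (τ : Equiv.Perm (Fin k)) (i : Fin k) :
    consPerm p τ i.succ = p.succAbove (τ i) := by
  simp [consPerm]

theorem consPerm_bijective (k : ℕ) :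
    Function.Bijective fun y : Fin (k + 1) × Equiv.Perm (Fin k) => consPerm y.1 y.2 := by
  rw [Fintype.bijective_iff_injective_and_card]
  refine ⟨?_, by simp [Fintype.card_perm, Nat.factorial_succ]⟩
  rintro ⟨p, τ⟩ ⟨p', τ'⟩ h
  simp only at h
  have hp : p = p' := by rw [← consPerm_zero p τ, h, consPerm_zero]
  subst hp
  refine Prod.ext rfl (Equiv.ext fun i => ?_)
  apply p.succAbove_right_injective
  rw [← consPerm_succ, h, consPerm_succ]

theorem permInversions_eq_sum {k : ℕ} (σ : Equiv.Perm (Fin k)) :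
    permInversions σ = ∑ a, ∑ b, if a < b ∧ σ b < σ a then 1 else 0 := by
  rw [permInversions, Finset.card_filter, Fintype.sum_prod_type]

theorem permInversions_consPerm {k : ℕ} (p : Fin (k + 1)) (τ : Equiv.Perm (Fin k)) :
    permInversions (consPerm p τ) = p + permInversions τ := by
  rw [permInversions_eq_sum, permInversions_eq_sum, Fin.sum_univ_succ]
  congr 1
  · rw [Fin.sum_univ_succ]
    simp only [lt_irrefl, false_and, if_false, zero_add, Fin.succ_pos, true_and, consPerm_zero,
      consPerm_succ]
    rw [Equiv.sum_comp τ fun b => if p.succAbove b < p then 1 else 0, ← Finset.card_filter]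
    simp only [Fin.succAbove_lt_iff_castSucc_lt]
    simp only [Fin.lt_def, Fin.val_castSucc]
    rw [Fin.card_filter_val_lt, min_eq_right p.is_le]
  · refine Finset.sum_congr rfl fun a _ => ?_
    rw [Fin.sum_univ_succ]
    simp [consPerm_succ, Fin.succ_lt_succ_iff]

section Exterior

variable {K A : Type} [Field K] [Ring A] [Algebra K A]

theorem rowMinor_ofFn (t : K) (x : ℕ → ℕ → A) {k : ℕ} (l : Fin k → ℕ) {J : Finset ℕ}
    (h : J.card = k) :
    rowMinor t x (List.ofFn l) J = ∑ σ : Equiv.Perm (Fin k), t ^ permInversions σ •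
      (List.ofFn fun d => x (l d) (J.orderEmbOfFin h (σ d))).prod := by
  induction k generalizing J with
  | zero =>
    obtain rfl := Finset.card_eq_zero.1 h
    simp [rowMinor, permInversions]
  | succ k ih =>
    rw [List.ofFn_succ, rowMinor, extMul, ← (consPerm_bijective k).sum_comp,
      Fintype.sum_prod_type]
    have hJ : J = Finset.univ.map (J.orderEmbOfFin h).toEmbedding := by
      ext a
      simp [-Set.mem_range]
    conv_lhs => rw [hJ]
    rw [Finset.sum_map, ← hJ]
    refine Finset.sum_congr rfl fun p _ => ?_
    have hp : (J.orderEmbOfFin h) p ∈ J := Finset.orderEmbOfFin_mem _ _ _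
    have hc : (J.erase (J.orderEmbOfFin h p)).card = k := by
      rw [Finset.card_erase_of_mem hp, h, Nat.add_sub_cancel]
    have he : (fun b => J.orderEmbOfFin h (p.succAbove b)) =
        (J.erase (J.orderEmbOfFin h p)).orderEmbOfFin hc := by
      apply Finset.orderEmbOfFin_unique
      · intro b
        simp [Fin.succAbove_ne]
      · exact (J.orderEmbOfFin h).strictMono.comp p.strictMono_succAbove
    simp only [RelEmbedding.coe_toEmbedding]
    rw [ih _ hc, belowCard_orderEmbOfFin, Finset.mul_sum, Finset.smul_sum]
    refine Finset.sum_congr rfl fun τ _ => ?_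
    rw [List.ofFn_succ, List.prod_cons, permInversions_consPerm, pow_add, mul_smul, mul_smul_comm,
      consPerm_zero]
    simp only [consPerm_succ, ← he]

theorem qMinor_eq_extMinor (q : K) (x : ℕ → ℕ → A) {I J : Finset ℕ} (h : I.card = J.card) :
    qMinor q x I J = extMinor (-q) x I J := by
  rw [qMinor, dif_pos h, extMinor, ← rowMinor_ofFn (-q) x (I.orderEmbOfFin rfl) h.symm,
    List.ofFn_eq_map, Finset.listMap_orderEmbOfFin_finRange]

theorem qMinor_congr (q : K) {x y : ℕ → ℕ → A} {I J : Finset ℕ}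
    (h : ∀ r ∈ I, ∀ c ∈ J, x r c = y r c) : qMinor q x I J = qMinor q y I J := by
  unfold qMinor
  split_ifs with hIJ
  · refine Finset.sum_congr rfl fun σ _ => ?_
    congr 3
    funext d
    exact h _ (Finset.orderEmbOfFin_mem _ _ _) _ (Finset.orderEmbOfFin_mem _ _ _)
  · rfl

/-- The matrix with the entries of `x` in the first `m` rows and `n` columns, and `0` elsewhere. -/
def truncate (m n : ℕ) (x : ℕ → ℕ → A) (r c : ℕ) : A :=
  if r ∈ Finset.Icc 1 m ∧ c ∈ Finset.Icc 1 n then x r c else 0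

theorem IsQMatrix.isFullQMatrix_truncate {q : K} {m n : ℕ} {x : ℕ → ℕ → A}
    (hx : IsQMatrix q m n x) : IsFullQMatrix q (truncate m n x) := by
  obtain ⟨hrow, hcol, hcomm, hcross⟩ := hx
  constructor
  · intro i j k h
    by_cases hi : i ∈ Finset.Icc 1 m <;> by_cases hj : j ∈ Finset.Icc 1 n <;>
      by_cases hk : k ∈ Finset.Icc 1 n <;> simp only [truncate, hi, hj, hk, and_self, and_true,
        and_false, if_true, if_false, mul_zero, zero_mul, smul_zero]
    rw [Finset.mem_Icc] at hi hj hk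
    exact hrow i j k hi.1 hi.2 hj.1 h hk.2
  · intro i l j h
    by_cases hi : i ∈ Finset.Icc 1 m <;> by_cases hl : l ∈ Finset.Icc 1 m <;>
      by_cases hj : j ∈ Finset.Icc 1 n <;> simp only [truncate, hi, hl, hj, and_self, and_true,
        and_false, if_true, if_false, mul_zero, zero_mul, smul_zero]
    rw [Finset.mem_Icc] at hi hl hj
    exact hcol i l j hi.1 h hl.2 hj.1 hj.2
  all_goals
    intro i l j k h h'
    by_cases hi : i ∈ Finset.Icc 1 m <;> by_cases hl : l ∈ Finset.Icc 1 m <;>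
      by_cases hj : j ∈ Finset.Icc 1 n <;> by_cases hk : k ∈ Finset.Icc 1 n <;>
      simp only [truncate, hi, hl, hj, hk, and_self, and_true, and_false, if_true, if_false,
        mul_zero, zero_mul, smul_zero, sub_self]
    rw [Finset.mem_Icc] at hi hl hj hk
  · exact hcomm i l j k hi.1 h hl.2 hj.1 h' hk.2
  · exact hcross i l j k hi.1 h hl.2 hj.1 h' hk.2

theorem flagMinor_eq_extMinor_truncate (q : K) (x : ℕ → ℕ → A) {m n : ℕ} {J : Finset ℕ}
    (hJ : J ⊆ Finset.Icc 1 n) (hm : J.card ≤ m) :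
    flagMinor q x J = extMinor (-q) (truncate m n x) (Finset.Icc 1 J.card) J := by
  rw [flagMinor, qMinor_congr q (y := truncate m n x), qMinor_eq_extMinor _ _ (by simp)]
  intro r hr c hc
  rw [truncate, if_pos ⟨Finset.Icc_subset_Icc_right hm hr, hJ hc⟩]

end Exterior

/-- The quantized Plücker-type relation `[Xj][Xik] = [Xij][Xk] + [Xjk][Xi]`. -/
theorem flag_triple_identity_a
    {K A : Type} [Field K] [Ring A] [Algebra K A] {m n : ℕ}
    (q : K) (hq : q ≠ 0) (x : ℕ → ℕ → A) (hx : IsQMatrix q m n x)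
    (i j k : ℕ) (h1i : 1 ≤ i) (hij : i < j) (hjk : j < k) (hkn : k ≤ n)
    (X : Finset ℕ) (hXn : X ⊆ Finset.Icc 1 n)
    (hiX : i ∉ X) (hjX : j ∉ X) (hkX : k ∉ X)
    (hm : X.card + 2 ≤ m) :
    flagMinor q x (insert j X) * flagMinor q x (insert i (insert k X)) =
      flagMinor q x (insert i (insert j X)) * flagMinor q x (insert k X) +
        flagMinor q x (insert j (insert k X)) * flagMinor q x (insert i X) := by
  have hiN : i ∈ Finset.Icc 1 n := Finset.mem_Icc.2 ⟨h1i, by omega⟩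
  have hjN : j ∈ Finset.Icc 1 n := Finset.mem_Icc.2 ⟨by omega, by omega⟩
  have hkN : k ∈ Finset.Icc 1 n := Finset.mem_Icc.2 ⟨by omega, hkn⟩
  have one : ∀ {a}, a ∈ Finset.Icc 1 n → a ∉ X → flagMinor q x (insert a X) =
      extMinor (-q) (truncate m n x) (Finset.Icc 1 (X.card + 1)) (insert a X) := by
    intro a haN ha
    have hc : (insert a X).card = X.card + 1 := Finset.card_insert_of_notMem ha
    rw [flagMinor_eq_extMinor_truncate (m := m) q x (Finset.insert_subset haN hXn) (by omega), hc]
  have two : ∀ {a b}, a < b → a ∈ Finset.Icc 1 n → a ∉ X → b ∈ Finset.Icc 1 n → b ∉ X →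
      flagMinor q x (insert a (insert b X)) =
      extMinor (-q) (truncate m n x) (Finset.Icc 1 (X.card + 2)) (insert a (insert b X)) := by
    intro a b hab haN ha hbN hb
    have hc : (insert a (insert b X)).card = X.card + 2 := by
      rw [Finset.card_insert_of_notMem (by simp [ha, hab.ne]), Finset.card_insert_of_notMem hb]
    rw [flagMinor_eq_extMinor_truncate (m := m) q x
      (Finset.insert_subset haN (Finset.insert_subset hbN hXn)) (by omega), hc]
  rw [one hjN hjX, one hkN hkX, one hiN hiX, two (hij.trans hjk) hiN hiX hkN hkX,
    two hij hiN hiX hjN hjX, two hjk hjN hjX hkN hkX]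
  exact hx.isFullQMatrix_truncate.extMinor_triple_identity hq
    (Finset.Icc_subset_Icc_right (by omega)) (by simp) hij hjk hiX hjX hkX
end
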